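/- arXiv:hep-th/9610137 — 7 statements merged into one kernel-verified Lean document; each statement's English description precedes it below -/
import Mathlib

section
/- Let p ≥ 1 and N ≥ 1 be integers, let z_1, …, z_N be complex numbers, let Z = diag(z_1,…,z_N), and let Y be any N×N complex matrix. Then the function t ↦ tr((Z + tY)^{p+1}) is a polynomial in t, and (1/(2(p+1))) · (d²/dt²)|_{t=0} tr((Z + tY)^{p+1}) = (1/2) Σ_{i=1}^N Σ_{j=1}^N Y_{ij} Y_{ji} σ_p(z_i, z_j), where σ_p(w, v) := Σ_{a+b=p−1, a,b≥0} w^a v^b. In particular, if z_i ≠ z_j then σ_p(z_i, z_j) = (z_i^p − z_j^p)/(z_i − z_j). -/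
open scoped BigOperators

theorem aux_hasDerivAt {N : ℕ} (Z Y : Matrix (Fin N) (Fin N) ℂ) (n : ℕ) (t : ℂ) :
    ∀ i j, HasDerivAt (fun t : ℂ => ((Z + t • Y) ^ n) i j)
      ((∑ a ∈ Finset.range n, (Z + t • Y) ^ a * Y * (Z + t • Y) ^ (n - 1 - a)) i j) t := by
  induction n with
  | zero => intro i j; simpa using hasDerivAt_const t _
  | succ n ih =>
    intro i j
    have hM : ∀ k l, HasDerivAt (fun t : ℂ => (Z + t • Y) k l) (Y k l) t := by
      intro k l
      simpa using ((hasDerivAt_id t).mul_const (Y k l)).const_add (Z k l)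
    have key : (∑ a ∈ Finset.range (n + 1), (Z + t • Y) ^ a * Y * (Z + t • Y) ^ (n + 1 - 1 - a))
        = (∑ a ∈ Finset.range n, (Z + t • Y) ^ a * Y * (Z + t • Y) ^ (n - 1 - a)) * (Z + t • Y)
          + (Z + t • Y) ^ n * Y := by
      rw [Finset.sum_range_succ, Finset.sum_mul]
      congr 1
      · refine Finset.sum_congr rfl fun a ha => ?_
        have ha := Finset.mem_range.1 ha
        rw [mul_assoc _ ((Z + t • Y) ^ (n - 1 - a)), ← pow_succ]
        congr 2
        omega
      · simp
    rw [key]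
    have h := HasDerivAt.fun_sum (u := Finset.univ)
      (fun k (_ : k ∈ Finset.univ) => (ih i k).mul (hM k j))
    simp only [pow_succ, Matrix.mul_apply (M := (Z + _ • Y) ^ n), Matrix.add_apply (A := _ * _),
      Matrix.mul_apply (N := Z + t • Y), ← Finset.sum_add_distrib]
    exact h

theorem aux_trace {N : ℕ} (Z Y B : Matrix (Fin N) (Fin N) ℂ) (n : ℕ) (t : ℂ) :
    HasDerivAt (fun t : ℂ => Matrix.trace ((Z + t • Y) ^ n * B))
      (Matrix.trace ((∑ a ∈ Finset.range n,
        (Z + t • Y) ^ a * Y * (Z + t • Y) ^ (n - 1 - a)) * B)) t := by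
  simp only [Matrix.trace, Matrix.diag_apply, Matrix.mul_apply (N := B)]
  exact HasDerivAt.fun_sum fun i _ => HasDerivAt.fun_sum fun k _ =>
    (aux_hasDerivAt Z Y n t i k).mul_const _

theorem aux_trace_one {N : ℕ} (Z Y : Matrix (Fin N) (Fin N) ℂ) (p : ℕ) (t : ℂ) :
    HasDerivAt (fun t : ℂ => Matrix.trace ((Z + t • Y) ^ (p + 1)))
      (((p : ℂ) + 1) * Matrix.trace ((Z + t • Y) ^ p * Y)) t := by
  have h := aux_trace Z Y 1 (p + 1) t
  simp only [mul_one] at h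
  convert h using 1
  rw [Matrix.trace_sum, Finset.sum_congr rfl (g := fun _ => Matrix.trace ((Z + t • Y) ^ p * Y))]
  · simp
  · intro a ha
    have ha := Finset.mem_range.1 ha
    rw [Matrix.trace_mul_comm, ← mul_assoc, ← pow_add]
    congr 3
    omega

/-- For `Z = diag(z₁,…,z_N)` and any `N×N` complex matrix `Y`, the map
`t ↦ tr((Z + tY)^(p+1))` is polynomial in `t`, its second derivative at `t = 0` divided by
`2(p+1)` equals `(1/2) ∑ᵢⱼ Yᵢⱼ Yⱼᵢ σ_p(zᵢ, zⱼ)` where `σ_p(w,v) = ∑_{a+b=p-1} wᵃ vᵇ`, and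
`σ_p(zᵢ,zⱼ) = (zᵢᵖ - zⱼᵖ)/(zᵢ - zⱼ)` whenever `zᵢ ≠ zⱼ`. -/
theorem statement1 (p N : ℕ) (hp : 1 ≤ p) (hN : 1 ≤ N)
    (z : Fin N → ℂ) (Y : Matrix (Fin N) (Fin N) ℂ) :
    (∃ q : Polynomial ℂ, ∀ t : ℂ,
        Matrix.trace ((Matrix.diagonal z + t • Y) ^ (p + 1)) = q.eval t) ∧
    (1 / (2 * ((p : ℂ) + 1))) *
        iteratedDeriv 2
          (fun t : ℂ => Matrix.trace ((Matrix.diagonal z + t • Y) ^ (p + 1))) 0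
      = (1 / 2) * ∑ i : Fin N, ∑ j : Fin N,
          Y i j * Y j i * ∑ a ∈ Finset.range p, z i ^ a * z j ^ (p - 1 - a) ∧
    (∀ i j : Fin N, z i ≠ z j →
      (∑ a ∈ Finset.range p, z i ^ a * z j ^ (p - 1 - a))
        = (z i ^ p - z j ^ p) / (z i - z j)) := by
  refine ⟨⟨Matrix.trace ((Matrix.diagonal (fun i => Polynomial.C (z i)) +
    (Polynomial.X : Polynomial ℂ) • Y.map Polynomial.C) ^ (p + 1)), fun t => ?_⟩, ?_, ?_⟩
  · rw [← Polynomial.coe_evalRingHom, AddMonoidHom.map_trace, ← RingHom.mapMatrix_apply, map_pow]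
    congr 2
    ext i j
    by_cases h : i = j
    · subst h; simp; ring
    · simp [h]; ring
  · have h1 : deriv (fun t : ℂ => Matrix.trace ((Matrix.diagonal z + t • Y) ^ (p + 1))) =
        fun t => ((p : ℂ) + 1) * Matrix.trace ((Matrix.diagonal z + t • Y) ^ p * Y) :=
      funext fun t => (aux_trace_one _ Y p t).deriv
    rw [iteratedDeriv_succ, iteratedDeriv_one, h1,
      ((aux_trace (Matrix.diagonal z) Y Y p 0).const_mul _).deriv]
    have hp' : (p : ℂ) + 1 ≠ 0 := by exact_mod_cast Nat.succ_ne_zero p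
    have h2 : Matrix.trace ((∑ a ∈ Finset.range p, (Matrix.diagonal z + (0 : ℂ) • Y) ^ a * Y *
        (Matrix.diagonal z + (0 : ℂ) • Y) ^ (p - 1 - a)) * Y) =
        ∑ i : Fin N, ∑ j : Fin N,
          Y i j * Y j i * ∑ a ∈ Finset.range p, z i ^ a * z j ^ (p - 1 - a) := by
      simp only [zero_smul, add_zero, Matrix.diagonal_pow, Matrix.trace, Matrix.diag_apply,
        Matrix.mul_apply (N := Y) (M := Finset.sum _ _), Matrix.sum_apply,
        Matrix.mul_diagonal, Matrix.diagonal_mul, Pi.pow_apply]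
      refine Finset.sum_congr rfl fun i _ => Finset.sum_congr rfl fun j _ => ?_
      rw [Finset.sum_mul, Finset.mul_sum]
      exact Finset.sum_congr rfl fun a _ => by ring
    rw [h2]
    field_simp
  · intro i j h
    exact geom₂_sum h p
end

section
/- Let p ≥ 2 and N ≥ 1 be integers. There exists a nonzero real constant κ, depending only on N, p and μ, such that for all pairwise distinct positive real numbers z_1, …, z_N: ∫_{H_N} exp(−q_Z(Y)) dμ(Y) = κ · (∏_{i=1}^N z_i^{−(p−1)/2}) · Δ(z)/Δ(z^p), where q_Z(Y) := (1/(2(p+1))) · (d²/dt²)|_{t=0} tr((Z + tY)^{p+1}), and Δ(z^p) := ∏_{1≤j<i≤N}(z_i^p − z_j^p). In particular the integral converges. -/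
open MeasureTheory
open scoped BigOperators

/-- The quadratic form `q_Z(Y) = (1/(2(p+1))) · (d²/dt²)|_{t=0} tr((Z + tY)^(p+1))`. -/
noncomputable def quadFormTrace (p N : ℕ) (z : Fin N → ℝ)
    (Y : Matrix (Fin N) (Fin N) ℂ) : ℂ :=
  (1 / (2 * ((p : ℂ) + 1))) *
    iteratedDeriv 2
      (fun t : ℝ =>
        Matrix.trace ((Matrix.diagonal (fun i => (z i : ℂ)) + t • Y) ^ (p + 1))) 0

theorem second_deriv_trace {A : Type*} [NormedRing A] [NormedAlgebra ℝ A] (τ : A →L[ℝ] ℂ)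
    (hτ : ∀ a b, τ (a * b) = τ (b * a)) (D Y : A) (p : ℕ) :
    iteratedDeriv 2 (fun t : ℝ => τ ((D + t • Y) ^ (p + 1))) 0 =
      ((p : ℂ) + 1) * τ (Y * ∑ i ∈ Finset.range p, D ^ (p - 1 - i) * Y * D ^ i) := by
  have h1 : ∀ t : ℝ, HasDerivAt (fun t : ℝ => D + t • Y) Y t := fun t => by
    simpa using HasDerivAt.const_add D ((hasDerivAt_id t).smul_const Y)
  have h2 : deriv (fun t : ℝ => τ ((D + t • Y) ^ (p + 1))) =
      fun t : ℝ => ((p : ℂ) + 1) * τ (Y * (D + t • Y) ^ p) := by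
    funext t
    have := (τ.hasFDerivAt.comp_hasDerivAt t ((h1 t).pow' (p + 1))).deriv
    refine Eq.trans this ?_
    rw [map_sum, Finset.sum_congr rfl (g := fun _ => τ (Y * (D + t • Y) ^ p))]
    · simp
    · intro i hi
      have hi := Finset.mem_range.1 hi
      rw [mul_assoc, hτ, mul_assoc, ← pow_add]
      congr 3
      simp only [Nat.pred_eq_sub_one]; omega
  rw [iteratedDeriv_succ, iteratedDeriv_one, h2]
  have h3 := ((τ.hasFDerivAt.comp_hasDerivAt (0:ℝ) (((h1 0).pow' p).const_mul Y)).const_mul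
    ((p : ℂ) + 1)).deriv
  refine Eq.trans h3 ?_
  simp

attribute [local instance] Matrix.linftyOpNormedRing Matrix.linftyOpNormedAlgebra in
theorem quadFormTrace_eq (p N : ℕ) (z : Fin N → ℝ) (Y : Matrix (Fin N) (Fin N) ℂ) :
    quadFormTrace p N z Y =
      1 / 2 * ∑ i, ∑ j, Y i j * Y j i * ∑ a ∈ Finset.range p, (z i : ℂ) ^ a * (z j : ℂ) ^ (p - 1 - a) := by
  have h := second_deriv_trace (A := Matrix (Fin N) (Fin N) ℂ)
    (LinearMap.toContinuousLinearMap (Matrix.traceLinearMap (Fin N) ℝ ℂ))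
    (fun a b => Matrix.trace_mul_comm a b) (Matrix.diagonal (fun i => (z i : ℂ))) Y p
  have h' : iteratedDeriv 2
      (fun t : ℝ =>
        Matrix.trace ((Matrix.diagonal (fun i => (z i : ℂ)) + t • Y) ^ (p + 1))) 0 = 
      ((p : ℂ) + 1) * Matrix.trace (Y * ∑ i ∈ Finset.range p, Matrix.diagonal (fun i => (z i : ℂ)) ^ (p - 1 - i) * Y * Matrix.diagonal (fun i => (z i : ℂ)) ^ i) := h
  have hp : (p : ℂ) + 1 ≠ 0 := by exact_mod_cast Nat.succ_ne_zero p
  rw [quadFormTrace, h', ← mul_assoc]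
  congr 1
  · field_simp
  · simp only [Matrix.trace, Matrix.diag, Matrix.mul_apply (M := Y), Matrix.sum_apply, Matrix.diagonal_pow,
      Matrix.diagonal_mul, Matrix.mul_diagonal, Pi.pow_apply]
    refine Finset.sum_congr rfl fun i _ => Finset.sum_congr rfl fun j _ => ?_
    rw [Finset.mul_sum, Finset.mul_sum]
    refine Finset.sum_congr rfl fun a _ => ?_
    ring

/-- `h_{p-1}(x,y)`. -/
noncomputable def hsym (p : ℕ) (x y : ℝ) : ℝ := ∑ a ∈ Finset.range p, x ^ a * y ^ (p - 1 - a)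

theorem hsym_comm (p : ℕ) (x y : ℝ) : hsym p x y = hsym p y x := by
  unfold hsym
  rw [← Finset.sum_range_reflect]
  refine Finset.sum_congr rfl fun a ha => ?_
  have := Finset.mem_range.1 ha
  rw [mul_comm, show p - 1 - (p - 1 - a) = a by omega]

theorem hsym_pos {p : ℕ} (hp : 2 ≤ p) {x y : ℝ} (hx : 0 < x) (hy : 0 < y) : 0 < hsym p x y :=
  Finset.sum_pos (fun a _ => by positivity) ⟨0, by simp; omega⟩

theorem hsym_self {p : ℕ} (x : ℝ) : hsym p x x = p * x ^ (p - 1) := by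
  unfold hsym
  rw [Finset.sum_congr rfl (g := fun _ => x ^ (p - 1))]
  · simp
  · intro a ha
    have := Finset.mem_range.1 ha
    rw [← pow_add]; congr 1; omega

theorem hsym_mul (p : ℕ) (x y : ℝ) : hsym p x y * (x - y) = x ^ p - y ^ p :=
  (Commute.all x y).geom_sum₂_mul p

/-- Hermitian matrices are identified with real matrices through `Re + Im`. -/
noncomputable def hermEquiv (N : ℕ) :
    selfAdjoint (Matrix (Fin N) (Fin N) ℂ) ≃+ (Fin N × Fin N → ℝ) where
  toFun Y := fun k => ((Y : Matrix (Fin N) (Fin N) ℂ) k.1 k.2).re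
    + ((Y : Matrix (Fin N) (Fin N) ℂ) k.1 k.2).im
  invFun M := ⟨Matrix.of fun i j => ⟨(M (i, j) + M (j, i)) / 2, (M (i, j) - M (j, i)) / 2⟩, by
    rw [selfAdjoint.mem_iff]
    ext i j
    apply Complex.ext
    · simp [Matrix.star_apply, add_comm]
    · simp [Matrix.star_apply]; ring⟩
  left_inv Y := by
    have h : ∀ i j, (Y : Matrix (Fin N) (Fin N) ℂ) j i = star ((Y : Matrix (Fin N) (Fin N) ℂ) i j) := fun i j => by
      conv_lhs => rw [← selfAdjoint.mem_iff.1 Y.2, Matrix.star_apply]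
    ext i j
    apply Complex.ext
    · simp [h i j]; ring
    · simp [h i j]
  right_inv M := by
    ext ⟨i, j⟩
    simp; ring
  map_add' X Y := by
    ext ⟨i, j⟩
    simp; ring

theorem hermEquiv_continuous (N : ℕ) : Continuous (hermEquiv N) := by
  refine continuous_pi fun k => ?_
  have : Continuous fun Y : selfAdjoint (Matrix (Fin N) (Fin N) ℂ) =>
    (Y : Matrix (Fin N) (Fin N) ℂ) k.1 k.2 := continuous_subtype_val.matrix_elem _ _
  exact (Complex.continuous_re.comp this).add (Complex.continuous_im.comp this)

theorem hermEquiv_symm_continuous (N : ℕ) : Continuous (hermEquiv N).symm := by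
  refine Continuous.subtype_mk (continuous_matrix fun i j => ?_) _
  have : Continuous fun M : Fin N × Fin N → ℝ =>
    ((M (i, j) + M (j, i)) / 2 : ℝ) + ((M (i, j) - M (j, i)) / 2 : ℝ) * Complex.I := by fun_prop
  convert this using 2 with M
  apply Complex.ext <;> simp

theorem quadFormTrace_herm (p N : ℕ) (z : Fin N → ℝ)
    (Y : selfAdjoint (Matrix (Fin N) (Fin N) ℂ)) :
    quadFormTrace p N z (Y : Matrix (Fin N) (Fin N) ℂ) =
      ((∑ k : Fin N × Fin N, hsym p (z k.1) (z k.2) / 2 * (hermEquiv N Y k) ^ 2 : ℝ) : ℂ) := by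
  have h : ∀ i j, (Y : Matrix (Fin N) (Fin N) ℂ) j i = star ((Y : Matrix (Fin N) (Fin N) ℂ) i j) := fun i j => by
      conv_lhs => rw [← selfAdjoint.mem_iff.1 Y.2, Matrix.star_apply]
  have hre : ∀ i j, ((Y : Matrix (Fin N) (Fin N) ℂ) j i).re = ((Y : Matrix (Fin N) (Fin N) ℂ) i j).re := fun i j => by simp [h i j]
  have him : ∀ i j, ((Y : Matrix (Fin N) (Fin N) ℂ) j i).im = -((Y : Matrix (Fin N) (Fin N) ℂ) i j).im := fun i j => by simp [h i j]
  have hc : ∑ i, ∑ j, hsym p (z i) (z j) * (((Y : Matrix (Fin N) (Fin N) ℂ) i j).re * ((Y : Matrix (Fin N) (Fin N) ℂ) i j).im) = 0 := by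
    have : ∀ s : ℝ, s = -s → s = 0 := fun s hs => by linarith
    apply this
    conv_lhs => rw [Finset.sum_comm]
    simp only [← Finset.sum_neg_distrib]
    refine Finset.sum_congr rfl fun i _ => Finset.sum_congr rfl fun j _ => ?_
    rw [hsym_comm, hre, him]; ring
  have e1 : ∑ k : Fin N × Fin N, hsym p (z k.1) (z k.2) / 2 * (hermEquiv N Y k) ^ 2
    = 1 / 2 * ∑ i, ∑ j, Complex.normSq ((Y : Matrix (Fin N) (Fin N) ℂ) i j) * hsym p (z i) (z j) := by
    rw [Fintype.sum_prod_type, ← add_zero (1 / 2 * _), ← hc, Finset.mul_sum, ← Finset.sum_add_distrib]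
    refine Finset.sum_congr rfl fun i _ => ?_
    rw [Finset.mul_sum, ← Finset.sum_add_distrib]
    refine Finset.sum_congr rfl fun j _ => ?_
    simp only [hermEquiv, AddEquiv.coe_mk, Equiv.coe_fn_mk, Complex.normSq_apply]
    ring
  rw [e1, quadFormTrace_eq]
  simp only [hsym]
  push_cast
  congr 1
  refine Finset.sum_congr rfl fun i _ => Finset.sum_congr rfl fun j _ => ?_
  rw [h i j, Complex.star_def, Complex.mul_conj]

theorem gauss_pi {ι : Type*} [Fintype ι] (b : ι → ℝ) (hb : ∀ k, 0 < b k) :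
    Integrable (fun x : ι → ℝ => Real.exp (-∑ k, b k * x k ^ 2)) ∧
    ∫ x : ι → ℝ, Real.exp (-∑ k, b k * x k ^ 2) = ∏ k, √(Real.pi / b k) := by
  have e : (fun x : ι → ℝ => Real.exp (-∑ k, b k * x k ^ 2)) =
     fun x => ∏ k, Real.exp (-b k * x k ^ 2) := by
    funext x
    rw [← Real.exp_sum, ← Finset.sum_neg_distrib]
    simp only [neg_mul]
  rw [e]
  constructor
  · exact Integrable.fintype_prod (f := fun k x => Real.exp (-b k * x ^ 2))
      fun k => integrable_exp_neg_mul_sq (hb k)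
  · rw [integral_fintype_prod_volume_eq_prod (fun k x => Real.exp (-b k * x ^ 2))]
    simp only [integral_gaussian]

theorem prod_sym {N : ℕ} (f : Fin N → Fin N → ℝ) (hf : ∀ i j, f i j = f j i) :
    ∏ k : Fin N × Fin N, f k.1 k.2 = (∏ i, f i i) * ∏ i, ∏ j ∈ Finset.Iio i, f i j ^ 2 := by
  rw [Fintype.prod_prod_type]
  have h1 : ∀ i : Fin N, ∏ j, f i j = f i i * ((∏ j ∈ Finset.Iio i, f i j) * ∏ j ∈ Finset.Ioi i, f i j) := by
    intro i
    have : (Finset.univ : Finset (Fin N)) = {i} ∪ (Finset.Iio i ∪ Finset.Ioi i) := by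
      ext j; simp; omega
    rw [this, Finset.prod_union, Finset.prod_union, Finset.prod_singleton]
    · rw [Finset.disjoint_left]; intro a; simp; omega
    · rw [Finset.disjoint_left]; intro a; simp
  simp only [h1, Finset.prod_mul_distrib, Finset.prod_pow]
  have h2 : ∏ i : Fin N, ∏ j ∈ Finset.Ioi i, f i j = ∏ i : Fin N, ∏ j ∈ Finset.Iio i, f i j := by
    rw [Finset.prod_comm' (t' := Finset.univ) (s' := fun j => Finset.Iio j)]
    · refine Finset.prod_congr rfl fun i _ => Finset.prod_congr rfl fun j _ => hf _ _
    · intro x y; simp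
  rw [h2]; ring

/-- Lemma 2.5 of the paper.  The Gaussian matrix integral
`∫_{H_N} exp(-q_Z(Y)) dμ(Y)` over the Hermitian matrices equals
`κ · ∏ zᵢ^{-(p-1)/2} · Δ(z)/Δ(zᵖ)` for a nonzero constant `κ` depending only on
`N`, `p` and the Haar measure `μ`. -/
theorem statement2 (p N : ℕ) (hp : 2 ≤ p) (hN : 1 ≤ N)
    [MeasurableSpace (selfAdjoint (Matrix (Fin N) (Fin N) ℂ))]
    [BorelSpace (selfAdjoint (Matrix (Fin N) (Fin N) ℂ))]
    (μ : Measure (selfAdjoint (Matrix (Fin N) (Fin N) ℂ))) [μ.IsAddHaarMeasure] :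
    ∃ κ : ℝ, κ ≠ 0 ∧
      ∀ z : Fin N → ℝ, (∀ i, 0 < z i) → Function.Injective z →
        Integrable
          (fun Y : selfAdjoint (Matrix (Fin N) (Fin N) ℂ) =>
            Complex.exp (-(quadFormTrace p N z (Y : Matrix (Fin N) (Fin N) ℂ)))) μ ∧
        (∫ Y : selfAdjoint (Matrix (Fin N) (Fin N) ℂ),
            Complex.exp (-(quadFormTrace p N z (Y : Matrix (Fin N) (Fin N) ℂ))) ∂μ)
          = ((κ * (∏ i : Fin N, z i ^ (-(((p : ℝ) - 1) / 2))) *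
              ((∏ i : Fin N, ∏ j ∈ Finset.Iio i, (z i - z j)) /
                (∏ i : Fin N, ∏ j ∈ Finset.Iio i, (z i ^ p - z j ^ p))) : ℝ) : ℂ) := by
  let e := hermEquiv N
  have : (μ.map e).IsAddHaarMeasure :=
    e.isAddHaarMeasure_map μ (hermEquiv_continuous N) (hermEquiv_symm_continuous N)
  let em : selfAdjoint (Matrix (Fin N) (Fin N) ℂ) ≃ᵐ (Fin N × Fin N → ℝ) :=
    (Homeomorph.mk e.toEquiv (hermEquiv_continuous N) (hermEquiv_symm_continuous N)).toMeasurableEquiv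
  obtain ⟨c, hc, hν⟩ : ∃ c : NNReal, 0 < c ∧ μ.map em = c • (volume : Measure (Fin N × Fin N → ℝ)) :=
    ⟨_, Measure.addHaarScalarFactor_pos_of_isAddHaarMeasure (μ.map e) volume,
      Measure.isAddLeftInvariant_eq_smul (μ.map e) volume⟩
  have mp : MeasurePreserving em μ (c • (volume : Measure (Fin N × Fin N → ℝ))) :=
    ⟨em.measurable, hν⟩
  refine ⟨c * ((∏ i : Fin N, √(Real.pi / (p / 2))) * ∏ i : Fin N, ∏ j ∈ Finset.Iio i, (2 * Real.pi)), ?_, ?_⟩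
  · have : (0 : ℝ) < p := by positivity
    have : (0 : ℝ) < c := hc
    positivity
  intro z hz hinj
  have hb : ∀ k : Fin N × Fin N, 0 < hsym p (z k.1) (z k.2) / 2 :=
    fun k => half_pos (hsym_pos hp (hz _) (hz _))
  obtain ⟨g1, g2⟩ := gauss_pi _ hb
  let F : (Fin N × Fin N → ℝ) → ℂ := fun x =>
    ((Real.exp (-∑ k : Fin N × Fin N, hsym p (z k.1) (z k.2) / 2 * x k ^ 2) : ℝ) : ℂ)
  have hF : (fun Y : selfAdjoint (Matrix (Fin N) (Fin N) ℂ) =>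
            Complex.exp (-(quadFormTrace p N z (Y : Matrix (Fin N) (Fin N) ℂ)))) = F ∘ em := by
    funext Y
    rw [quadFormTrace_herm, ← Complex.ofReal_neg, ← Complex.ofReal_exp]
    rfl
  rw [hF]
  constructor
  · rw [mp.integrable_comp_emb em.measurableEmbedding]
    exact (g1.ofReal (𝕜 := ℂ)).smul_measure_nnreal
  · have : ∫ Y, (F ∘ em) Y ∂μ = ∫ x, F x ∂(c • (volume : Measure (Fin N × Fin N → ℝ))) :=
      mp.integral_comp em.measurableEmbedding F
    rw [this, integral_smul_nnreal_measure]
    simp only [F]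
    rw [integral_complex_ofReal, g2, NNReal.smul_def, Complex.real_smul, ← Complex.ofReal_mul]
    congr 1
    rw [prod_sym (fun i j => √(Real.pi / (hsym p (z i) (z j) / 2)))
      (fun i j => by simp only [hsym_comm])]
    rw [mul_assoc, mul_assoc]
    congr 1
    have t1 : ∀ i, √(Real.pi / (hsym p (z i) (z i) / 2)) =
        √(Real.pi / (p / 2)) * z i ^ (-(((p : ℝ) - 1) / 2)) := by
      intro i
      have : z i ^ (-(((p : ℝ) - 1) / 2)) = √((z i ^ (p - 1))⁻¹) := by
        rw [Real.sqrt_eq_rpow, ← Real.rpow_natCast, ← Real.rpow_neg (hz i).le,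
          ← Real.rpow_mul (hz i).le, Nat.cast_sub (by omega)]
        congr 1; push_cast; ring
      rw [this, ← Real.sqrt_mul (by positivity), hsym_self]
      congr 1
      have := hz i
      field_simp
    have t2 : ∀ i j, j ∈ Finset.Iio i → √(Real.pi / (hsym p (z i) (z j) / 2)) ^ 2 =
        (2 * Real.pi) * ((z i - z j) / (z i ^ p - z j ^ p)) := by
      intro i j hij
      have hne : z i - z j ≠ 0 := sub_ne_zero.2 fun h => (Finset.mem_Iio.1 hij).ne (hinj h).symm
      have := hsym_pos hp (hz i) (hz j)
      rw [Real.sq_sqrt (by positivity), ← hsym_mul]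
      field_simp
    rw [Finset.prod_congr rfl fun i _ => t1 i,
      Finset.prod_congr rfl fun i _ => Finset.prod_congr rfl fun j hj => t2 i j hj]
    simp only [Finset.prod_mul_distrib, Finset.prod_div_distrib]
    ring
end

section
/- Let N ≥ 1 be an integer and let V be a polynomial with real coefficients. There exists a nonzero real constant κ_N, depending only on N and μ, such that for all pairwise distinct real numbers z_1, …, z_N satisfying V''(z_i) > 0 for every i and (V'(z_i) − V'(z_j))/(z_i − z_j) > 0 for every i ≠ j: ∫_{H_N} exp(−q_{V,Z}(Y)) dμ(Y) = κ_N · (Δ(z)/Δ(V'(z))) · ∏_{i=1}^N V''(z_i)^{−1/2}, where q_{V,Z}(Y) := (1/2) · (d²/dt²)|_{t=0} tr V(Z + tY), and Δ(V'(z)) := ∏_{1≤j<i≤N}(V'(z_i) − V'(z_j)). In particular the integral converges. -/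
open MeasureTheory
open scoped BigOperators

/-- The quadratic form `q_{V,Z}(Y) = (1/2) · (d²/dt²)|_{t=0} tr V(Z + tY)`. -/
noncomputable def quadFormTraceV (N : ℕ) (V : Polynomial ℝ) (z : Fin N → ℝ)
    (Y : Matrix (Fin N) (Fin N) ℂ) : ℂ :=
  (1 / 2) *
    iteratedDeriv 2
      (fun t : ℝ =>
        Matrix.trace
          (Polynomial.aeval (Matrix.diagonal (fun i => (z i : ℂ)) + t • Y) V)) 0

section helpers

set_option linter.unusedSimpArgs false

/-- `Z + tY`. -/
noncomputable def curveM (N : ℕ) (z : Fin N → ℝ) (Y : Matrix (Fin N) (Fin N) ℂ) (t : ℝ) :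
    Matrix (Fin N) (Fin N) ℂ :=
  Matrix.diagonal (fun i => (z i : ℂ)) + t • Y

/-- Divided difference of the powers. -/
def ddPow (a b : ℝ) : ℕ → ℝ
  | 0 => 0
  | n + 1 => ddPow a b n * b + a ^ n

lemma ddPow_mul (a b : ℝ) (n : ℕ) : ddPow a b n * (a - b) = a ^ n - b ^ n := by
  induction n with
  | zero => simp [ddPow]
  | succ n ih =>
    simp only [ddPow]
    linear_combination b * ih

lemma ddPow_self (a : ℝ) (n : ℕ) : ddPow a a n = n * a ^ (n - 1) := by
  induction n with
  | zero => simp [ddPow]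
  | succ n ih =>
    simp only [ddPow, ih]
    cases n with
    | zero => simp
    | succ n => simp; ring

/-- Divided difference of a polynomial. -/
noncomputable def ddPoly (W : Polynomial ℝ) (a b : ℝ) : ℝ := W.sum fun n c => c * ddPow a b n

lemma ddPoly_add (W₁ W₂ : Polynomial ℝ) (a b : ℝ) :
    ddPoly (W₁ + W₂) a b = ddPoly W₁ a b + ddPoly W₂ a b := by
  unfold ddPoly
  apply Polynomial.sum_add_index <;> intros <;> ring

lemma ddPoly_monomial (n : ℕ) (c a b : ℝ) :
    ddPoly (Polynomial.monomial n c) a b = c * ddPow a b n := by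
  unfold ddPoly
  rw [Polynomial.sum_monomial_index]; ring

lemma ddPoly_mul (W : Polynomial ℝ) (a b : ℝ) :
    ddPoly W a b * (a - b) = W.eval a - W.eval b := by
  induction W using Polynomial.induction_on' with
  | add p q hp hq => rw [ddPoly_add, Polynomial.eval_add, Polynomial.eval_add]; linarith
  | monomial n c =>
    rw [ddPoly_monomial, Polynomial.eval_monomial, Polynomial.eval_monomial]
    linear_combination c * ddPow_mul a b n

lemma ddPoly_self (W : Polynomial ℝ) (a : ℝ) :
    ddPoly W a a = W.derivative.eval a := by
  induction W using Polynomial.induction_on' with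
  | add p q hp hq => rw [ddPoly_add, Polynomial.derivative_add, Polynomial.eval_add, hp, hq]
  | monomial n c =>
    rw [ddPoly_monomial, Polynomial.derivative_monomial, Polynomial.eval_monomial, ddPow_self]
    ring

lemma curveM_zero (N : ℕ) (z : Fin N → ℝ) (Y : Matrix (Fin N) (Fin N) ℂ) :
    curveM N z Y 0 = Matrix.diagonal (fun i => (z i : ℂ)) := by
  simp [curveM]

lemma curveM_entry (N : ℕ) (z : Fin N → ℝ) (Y : Matrix (Fin N) (Fin N) ℂ) (i j : Fin N) (t : ℝ) :
    HasDerivAt (fun t => curveM N z Y t i j) (Y i j) t := by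
  simp only [curveM, Matrix.add_apply, Matrix.smul_apply]
  have := ((hasDerivAt_id t).smul_const (Y i j)).const_add
    (Matrix.diagonal (fun i => (z i : ℂ)) i j)
  simpa using this

lemma curveM_pow_entry (N : ℕ) (z : Fin N → ℝ) (Y : Matrix (Fin N) (Fin N) ℂ) (n : ℕ) :
    ∀ i j : Fin N,
    HasDerivAt (fun t => (curveM N z Y t ^ n) i j) (Y i j * (ddPow (z i) (z j) n : ℝ)) 0 := by
  induction n with
  | zero => intro i j; simpa [ddPow] using hasDerivAt_const (0:ℝ) ((1 : Matrix (Fin N) (Fin N) ℂ) i j)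
  | succ n ih =>
    intro i j
    simp only [pow_succ, Matrix.mul_apply]
    have := HasDerivAt.fun_sum (u := Finset.univ)
      (fun k _ => (ih i k).mul (curveM_entry N z Y k j 0))
    refine this.congr_deriv ?_
    rw [Finset.sum_add_distrib, curveM_zero, Matrix.diagonal_pow]
    simp [Matrix.diagonal_apply, ddPow]
    ring

lemma curveM_aeval_entry (N : ℕ) (z : Fin N → ℝ) (Y : Matrix (Fin N) (Fin N) ℂ)
    (W : Polynomial ℝ) (i j : Fin N) :
    HasDerivAt (fun t => (Polynomial.aeval (curveM N z Y t) W) i j)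
      (Y i j * (ddPoly W (z i) (z j) : ℝ)) 0 := by
  induction W using Polynomial.induction_on' with
  | add p q hp hq =>
    simp only [map_add, Matrix.add_apply, ddPoly_add]
    refine (hp.add hq).congr_deriv ?_
    push_cast; ring
  | monomial n c =>
    simp only [Polynomial.aeval_monomial, ddPoly_monomial, ← Algebra.smul_def, Matrix.smul_apply]
    refine ((curveM_pow_entry N z Y n i j).const_smul c).congr_deriv ?_
    simp; ring

attribute [local instance] Matrix.linftyOpNormedRing Matrix.linftyOpNormedAlgebra in
lemma curveM_pow_trace (N : ℕ) (z : Fin N → ℝ) (Y : Matrix (Fin N) (Fin N) ℂ) (n : ℕ) (t : ℝ) :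
    HasDerivAt (fun t => (curveM N z Y t ^ n).trace)
      (n * (Y * curveM N z Y t ^ (n - 1)).trace) t := by
  have h0 : HasDerivAt (curveM N z Y) Y t := by
    have := ((hasDerivAt_id t).smul_const Y).const_add
      (Matrix.diagonal (fun i => (z i : ℂ)))
    rw [one_smul] at this
    exact this
  have h1 := h0.fun_pow' n
  have h2 := (LinearMap.toContinuousLinearMap
    (Matrix.traceLinearMap (Fin N) ℝ ℂ)).hasFDerivAt.comp_hasDerivAt t h1
  refine HasDerivAt.congr_deriv (f := fun t => (curveM N z Y t ^ n).trace) h2 ?_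
  change (∑ i ∈ Finset.range n,
    curveM N z Y t ^ (n.pred - i) * Y * curveM N z Y t ^ i).trace = _
  rw [Matrix.trace_sum]
  rw [Finset.sum_congr rfl (g := fun _ => (Y * curveM N z Y t ^ (n - 1)).trace)]
  · simp
  · intro k hk
    rw [Finset.mem_range] at hk
    rw [mul_assoc, Matrix.trace_mul_comm, mul_assoc, ← pow_add]
    congr 3
    simp; omega

lemma curveM_aeval_trace (N : ℕ) (z : Fin N → ℝ) (Y : Matrix (Fin N) (Fin N) ℂ)
    (W : Polynomial ℝ) (t : ℝ) :
    HasDerivAt (fun t => (Polynomial.aeval (curveM N z Y t) W).trace)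
      (Y * Polynomial.aeval (curveM N z Y t) W.derivative).trace t := by
  induction W using Polynomial.induction_on' with
  | add p q hp hq =>
    simp only [map_add, Matrix.trace_add, mul_add]
    exact hp.add hq
  | monomial n c =>
    simp only [Polynomial.aeval_monomial, Polynomial.derivative_monomial, ← Algebra.smul_def,
      Matrix.trace_smul, Matrix.mul_smul]
    refine ((curveM_pow_trace N z Y n t).const_smul c).congr_deriv ?_
    simp; ring

lemma quadForm_eq (N : ℕ) (V : Polynomial ℝ) (z : Fin N → ℝ) (Y : Matrix (Fin N) (Fin N) ℂ) :
    quadFormTraceV N V z Y =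
      (1 / 2) * ∑ i, ∑ j, Y i j * Y j i * (ddPoly V.derivative (z j) (z i) : ℝ) := by
  unfold quadFormTraceV
  congr 1
  rw [iteratedDeriv_succ, iteratedDeriv_one]
  have h1 : deriv (fun t : ℝ => Matrix.trace
          (Polynomial.aeval (Matrix.diagonal (fun i => (z i : ℂ)) + t • Y) V)) =
      fun t => (Y * Polynomial.aeval (curveM N z Y t) V.derivative).trace := by
    funext t
    exact (curveM_aeval_trace N z Y V t).deriv
  rw [h1]
  apply HasDerivAt.deriv
  simp only [Matrix.trace, Matrix.diag_apply, Matrix.mul_apply]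
  refine HasDerivAt.fun_sum fun i _ => HasDerivAt.fun_sum fun j _ => ?_
  refine ((curveM_aeval_entry N z Y V.derivative j i).const_mul (Y i j)).congr_deriv ?_
  ring

@[to_additive]
lemma prod_prod_split {M : Type*} [CommMonoid M] (N : ℕ) (g : Fin N → Fin N → M) :
    ∏ i, ∏ j, g i j = (∏ i, g i i) * ∏ i, ∏ j ∈ Finset.Iio i, (g i j * g j i) := by
  have h1 : ∀ i, ∏ j, g i j = g i i * ((∏ j ∈ Finset.Iio i, g i j) * ∏ j ∈ Finset.Ioi i, g i j) := by
    intro i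
    have : (Finset.univ : Finset (Fin N)) = insert i (Finset.Iio i ∪ Finset.Ioi i) := by
      ext j; simp; grind
    rw [this, Finset.prod_insert (by simp), Finset.prod_union]
    rw [Finset.disjoint_left]; intro j; simp; grind
  have h2 : ∏ i, ∏ j ∈ Finset.Ioi i, g i j = ∏ i, ∏ j ∈ Finset.Iio i, g j i := by
    apply Finset.prod_comm'
    simp
  simp only [h1, Finset.prod_mul_distrib, h2]

/-- Real coordinates on Hermitian matrices. -/
noncomputable def hermCoord (N : ℕ) :
    selfAdjoint (Matrix (Fin N) (Fin N) ℂ) ≃+ (Fin N × Fin N → ℝ) where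
  toFun Y p := if p.2 ≤ p.1 then ((Y : Matrix (Fin N) (Fin N) ℂ) p.1 p.2).re
    else ((Y : Matrix (Fin N) (Fin N) ℂ) p.1 p.2).im
  invFun f := ⟨Matrix.of fun i j => if i = j then (f (i, i) : ℂ) else
      if j < i then ⟨f (i, j), - f (j, i)⟩ else ⟨f (j, i), f (i, j)⟩, by
    rw [selfAdjoint.mem_iff]
    ext i j
    rw [Matrix.star_apply, Matrix.of_apply, Matrix.of_apply]
    rcases lt_trichotomy i j with h | h | h
    · simp [h, h.ne, h.ne', h.not_gt, Complex.ext_iff]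
    · subst h; simp
    · simp [h, h.ne, h.ne', h.not_gt, Complex.ext_iff]⟩
  left_inv Y := by
    have hY : ∀ i j, (Y : Matrix (Fin N) (Fin N) ℂ) j i =
        star ((Y : Matrix (Fin N) (Fin N) ℂ) i j) := fun i j => by
      have := selfAdjoint.mem_iff.1 Y.2
      rw [← Matrix.star_apply, this]
    ext i j
    rcases lt_trichotomy i j with h | h | h
    · simp [h, h.le, h.ne, h.ne', h.not_gt, h.not_ge, hY i j, Complex.ext_iff]
    · subst h
      have := congrArg Complex.im (hY i i)
      simp at this
      simp [Complex.ext_iff]; linarith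
    · simp [h, h.le, h.ne, h.ne', h.not_gt, h.not_ge, hY i j, Complex.ext_iff]
  right_inv f := by
    ext ⟨i, j⟩
    rcases lt_trichotomy i j with h | h | h
    · simp [h, h.le, h.ne, h.ne', h.not_gt, h.not_ge]
    · subst h; simp
    · simp [h, h.le, h.ne, h.ne', h.not_gt, h.not_ge]
  map_add' X Y := by
    ext ⟨i, j⟩
    simp only [AddSubgroup.coe_add, Matrix.add_apply, Complex.add_re, Complex.add_im, Pi.add_apply]
    split_ifs <;> rfl

lemma hermCoord_cont (N : ℕ) : Continuous (hermCoord N) := by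
  refine continuous_pi fun p => ?_
  have h : Continuous fun Y : selfAdjoint (Matrix (Fin N) (Fin N) ℂ) =>
      (Y : Matrix (Fin N) (Fin N) ℂ) p.1 p.2 :=
    continuous_subtype_val.matrix_elem p.1 p.2
  by_cases hp : p.2 ≤ p.1
  · simpa [hermCoord, hp] using! Complex.continuous_re.comp h
  · simpa [hermCoord, hp] using! Complex.continuous_im.comp h

lemma hermCoord_symm_cont (N : ℕ) : Continuous (hermCoord N).symm := by
  refine Continuous.subtype_mk (continuous_matrix fun i j => ?_) _
  simp only [Matrix.of_apply]
  split_ifs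
  · fun_prop
  · simp only [Complex.mk_eq_add_mul_I]; fun_prop
  · simp only [Complex.mk_eq_add_mul_I]; fun_prop

/-- Coefficients of the quadratic form in real coordinates. -/
noncomputable def bcoef (N : ℕ) (V : Polynomial ℝ) (z : Fin N → ℝ) (p : Fin N × Fin N) : ℝ :=
  if p.1 = p.2 then V.derivative.derivative.eval (z p.1) / 2 else
    (V.derivative.eval (z p.1) - V.derivative.eval (z p.2)) / (z p.1 - z p.2)

lemma quadForm_coord (N : ℕ) (V : Polynomial ℝ) (z : Fin N → ℝ) (hz : Function.Injective z)
    (f : Fin N × Fin N → ℝ) :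
    quadFormTraceV N V z ((hermCoord N).symm f : Matrix (Fin N) (Fin N) ℂ) =
      ((∑ p, bcoef N V z p * f p ^ 2 : ℝ) : ℂ) := by
  have hd : ∀ i j, i ≠ j → ddPoly V.derivative (z i) (z j) =
      (V.derivative.eval (z i) - V.derivative.eval (z j)) / (z i - z j) := by
    intro i j hij
    rw [eq_div_iff (sub_ne_zero.2 (hz.ne hij)), ddPoly_mul]
  have hs : ∀ i j, (V.derivative.eval (z i) - V.derivative.eval (z j)) / (z i - z j) =
      (V.derivative.eval (z j) - V.derivative.eval (z i)) / (z j - z i) := by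
    intro i j
    rw [← neg_sub (V.derivative.eval (z j)), ← neg_sub (z j), neg_div_neg_eq]
  rw [quadForm_eq, Fintype.sum_prod_type, sum_sum_split, sum_sum_split, mul_add,
    Complex.ofReal_add, Complex.ofReal_sum, Complex.ofReal_sum, Finset.mul_sum, Finset.mul_sum]
  congr 1
  · refine Finset.sum_congr rfl fun i _ => ?_
    rw [ddPoly_self]
    simp [hermCoord, bcoef]; ring
  · refine Finset.sum_congr rfl fun i _ => ?_
    rw [Finset.mul_sum, Complex.ofReal_sum]
    refine Finset.sum_congr rfl fun j hj => ?_
    have h : j < i := Finset.mem_Iio.1 hj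
    rw [hd j i h.ne, hd i j h.ne', hs j i]
    have e1 : ((hermCoord N).symm f : Matrix (Fin N) (Fin N) ℂ) i j =
        f (i, j) - f (j, i) * Complex.I := by
      simp [hermCoord, h, h.ne', Complex.ext_iff]
    have e2 : ((hermCoord N).symm f : Matrix (Fin N) (Fin N) ℂ) j i =
        f (i, j) + f (j, i) * Complex.I := by
      simp [hermCoord, h.not_gt, h.ne, Complex.ext_iff]
    rw [e1, e2]
    simp only [bcoef, h.ne, h.ne', if_false]
    rw [hs j i]
    push_cast
    linear_combination (-(f (j, i) : ℂ) ^ 2 * ((((V.derivative.eval (z i) : ℝ) : ℂ) - ((V.derivative.eval (z j) : ℝ) : ℂ)) / ((z i : ℂ) - z j))) * Complex.I_sq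

end helpers

/-- Remark after Lemma 2.5 of the paper.  For a real polynomial `V`,
`∫_{H_N} exp(-q_{V,Z}(Y)) dμ(Y) = κ_N · Δ(z)/Δ(V'(z)) · ∏ V''(zᵢ)^{-1/2}` with a nonzero
constant `κ_N` depending only on `N` and the Haar measure `μ`. -/
theorem statement3 (N : ℕ) (hN : 1 ≤ N)
    [MeasurableSpace (selfAdjoint (Matrix (Fin N) (Fin N) ℂ))]
    [BorelSpace (selfAdjoint (Matrix (Fin N) (Fin N) ℂ))]
    (μ : Measure (selfAdjoint (Matrix (Fin N) (Fin N) ℂ))) [μ.IsAddHaarMeasure] :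
    ∃ κ : ℝ, κ ≠ 0 ∧
      ∀ (V : Polynomial ℝ) (z : Fin N → ℝ), Function.Injective z →
        (∀ i, 0 < V.derivative.derivative.eval (z i)) →
        (∀ i j, i ≠ j →
          0 < (V.derivative.eval (z i) - V.derivative.eval (z j)) / (z i - z j)) →
        Integrable
          (fun Y : selfAdjoint (Matrix (Fin N) (Fin N) ℂ) =>
            Complex.exp (-(quadFormTraceV N V z (Y : Matrix (Fin N) (Fin N) ℂ)))) μ ∧
        (∫ Y : selfAdjoint (Matrix (Fin N) (Fin N) ℂ),
            Complex.exp (-(quadFormTraceV N V z (Y : Matrix (Fin N) (Fin N) ℂ))) ∂μ)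
          = ((κ *
              ((∏ i : Fin N, ∏ j ∈ Finset.Iio i, (z i - z j)) /
                (∏ i : Fin N, ∏ j ∈ Finset.Iio i,
                  (V.derivative.eval (z i) - V.derivative.eval (z j)))) *
              ∏ i : Fin N, (V.derivative.derivative.eval (z i)) ^ (-(1 : ℝ) / 2) : ℝ) : ℂ) := by
  obtain ⟨c, hc0, hc⟩ : ∃ c : NNReal, c ≠ 0 ∧ μ.map (hermCoord N) = c • volume := by
    have hm : (μ.map (hermCoord N)).IsAddHaarMeasure :=
      (hermCoord N).isAddHaarMeasure_map μ (hermCoord_cont N) (hermCoord_symm_cont N)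
    refine ⟨_, ?_, Measure.isAddLeftInvariant_eq_smul (μ.map (hermCoord N)) volume⟩
    exact (Measure.addHaarScalarFactor_pos_of_isAddHaarMeasure _ _).ne'
  let eH : selfAdjoint (Matrix (Fin N) (Fin N) ℂ) ≃ₜ (Fin N × Fin N → ℝ) :=
    { (hermCoord N).toEquiv with
      continuous_toFun := hermCoord_cont N
      continuous_invFun := hermCoord_symm_cont N }
  have hemb : MeasurableEmbedding (hermCoord N) := eH.measurableEmbedding
  refine ⟨c * ((∏ _i : Fin N, √(2 * Real.pi)) * ∏ i : Fin N, ∏ _j ∈ Finset.Iio i, Real.pi), ?_, ?_⟩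
  · have := Real.pi_pos
    have := NNReal.coe_ne_zero.2 hc0
    positivity
  intro V z hz h2 hD
  have hb : ∀ p, 0 < bcoef N V z p := by
    intro p
    unfold bcoef
    split_ifs with h
    · exact half_pos (h2 _)
    · exact hD _ _ h
  have hfun : (fun Y : selfAdjoint (Matrix (Fin N) (Fin N) ℂ) =>
      Complex.exp (-(quadFormTraceV N V z (Y : Matrix (Fin N) (Fin N) ℂ)))) =
      (fun f : Fin N × Fin N → ℝ => ((∏ p, Real.exp (-bcoef N V z p * f p ^ 2) : ℝ) : ℂ)) ∘
        (hermCoord N) := by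
    funext Y
    have := quadForm_coord N V z hz (hermCoord N Y)
    rw [AddEquiv.symm_apply_apply] at this
    rw [this, Function.comp_apply, ← Real.exp_sum, ← Complex.ofReal_neg, ← Complex.ofReal_exp,
      ← Finset.sum_neg_distrib]
    simp only [neg_mul]
  have hint : Integrable (fun f : Fin N × Fin N → ℝ =>
      (∏ p, Real.exp (-bcoef N V z p * f p ^ 2) : ℝ)) volume :=
    Integrable.fintype_prod (f := fun p x => Real.exp (-bcoef N V z p * x ^ 2))
      (fun p => integrable_exp_neg_mul_sq (hb p))
  constructor
  · rw [hfun, ← hemb.integrable_map_iff, hc]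
    exact hint.ofReal.smul_measure_nnreal
  · rw [hfun]
    simp only [Function.comp_def]
    rw [← hemb.integral_map (fun f : Fin N × Fin N → ℝ =>
      ((∏ p, Real.exp (-bcoef N V z p * f p ^ 2) : ℝ) : ℂ)), hc, integral_smul_nnreal_measure,
      integral_complex_ofReal, integral_fintype_prod_volume_eq_prod
        (fun p (x : ℝ) => Real.exp (-bcoef N V z p * x ^ 2))]
    simp only [integral_gaussian]
    rw [NNReal.smul_def, Complex.real_smul, ← Complex.ofReal_mul]
    congr 1
    rw [Fintype.prod_prod_type, prod_prod_split]
    have e1 : ∀ i, √(Real.pi / bcoef N V z (i, i)) =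
        √(2 * Real.pi) * (V.derivative.derivative.eval (z i)) ^ (-(1 : ℝ) / 2) := by
      intro i
      simp only [bcoef, if_true]
      rw [neg_div, Real.rpow_neg (h2 i).le, ← Real.sqrt_eq_rpow, ← Real.sqrt_inv,
        ← Real.sqrt_mul (by positivity)]
      congr 1
      have := (h2 i).ne'
      field_simp
    have e2 : ∀ i, ∀ j ∈ Finset.Iio i,
        √(Real.pi / bcoef N V z (i, j)) * √(Real.pi / bcoef N V z (j, i)) =
        Real.pi * ((z i - z j) / (V.derivative.eval (z i) - V.derivative.eval (z j))) := by
      intro i j hj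
      have h : j < i := Finset.mem_Iio.1 hj
      have hs : bcoef N V z (j, i) = bcoef N V z (i, j) := by
        simp only [bcoef, h.ne, h.ne', if_false]
        rw [← neg_sub (V.derivative.eval (z i)), ← neg_sub (z i), neg_div_neg_eq]
      rw [hs, Real.mul_self_sqrt (div_nonneg Real.pi_pos.le (hb _).le)]
      simp only [bcoef, h.ne', if_false]
      rw [div_div_eq_mul_div, mul_div_assoc]
    rw [Finset.prod_congr rfl fun i _ => e1 i,
      Finset.prod_congr rfl fun i _ => Finset.prod_congr rfl (e2 i)]
    simp only [Finset.prod_mul_distrib, Finset.prod_div_distrib]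
    ring
end

section
/- Let N ≥ 1 be an integer. There exists a nonzero constant κ_N, depending only on N, such that for all real numbers x_1 > x_2 > ⋯ > x_N and y_1 > y_2 > ⋯ > y_N (any pairwise distinct tuples suffice), with X = diag(x_1,…,x_N) and Y = diag(y_1,…,y_N): ∫_{U(N)} exp( tr(X U Y U*) ) dν(U) = κ_N · det( e^{x_i y_j} )_{1≤i,j≤N} / (Δ(x) Δ(y)), where ν is the Haar probability measure on the unitary group U(N), U* is the conjugate transpose of U, and Δ(x) = ∏_{1≤j<i≤N}(x_i − x_j). -/
section helpers
open MeasureTheory Filter Topology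

namespace HCIZ

abbrev UG (N : ℕ) := ↥(Matrix.unitaryGroup (Fin N) ℂ)

instance instSecondCountableMat (N : ℕ) : SecondCountableTopology (Matrix (Fin N) (Fin N) ℂ) :=
  inferInstanceAs (SecondCountableTopology (Fin N → Fin N → ℂ))

instance instSecondCountableUG (N : ℕ) : SecondCountableTopology (UG N) :=
  TopologicalSpace.Subtype.secondCountableTopology _

instance instCompactUG (N : ℕ) : CompactSpace (UG N) := by
  apply isCompact_iff_compactSpace.mp
  have h1 : IsClosed ((Matrix.unitaryGroup (Fin N) ℂ : Set (Matrix (Fin N) (Fin N) ℂ))) := by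
    have : ((Matrix.unitaryGroup (Fin N) ℂ : Set (Matrix (Fin N) (Fin N) ℂ)))
        = {A | A * star A = 1} := by
      ext A
      exact Matrix.mem_unitaryGroup_iff
    rw [this]
    exact isClosed_eq (by fun_prop) continuous_const
  have h2 : IsCompact (Set.pi Set.univ (fun _ : Fin N => Set.pi Set.univ
      (fun _ : Fin N => Metric.closedBall (0 : ℂ) 1))) :=
    isCompact_univ_pi (fun _ => isCompact_univ_pi (fun _ => isCompact_closedBall _ _))
  refine IsCompact.of_isClosed_subset h2 h1 ?_
  intro A hA i _ j _
  simpa using entry_norm_bound_of_unitary hA i j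

section generic

variable {K : Type*} [TopologicalSpace K] [CompactSpace K] [MeasurableSpace K] [BorelSpace K]

lemma integrable_cont (ν : Measure K) [IsFiniteMeasure ν] {f : K → ℝ} (hf : Continuous f) :
    Integrable f ν := by
  obtain ⟨C, hC⟩ := (isCompact_range hf).isBounded.exists_norm_le
  exact Integrable.of_bound hf.aestronglyMeasurable C
    (Eventually.of_forall fun k => hC _ ⟨k, rfl⟩)

lemma hasDerivAt_int (ν : Measure K) [IsFiniteMeasure ν] (F F' : ℝ → K → ℝ)
    (hF : Continuous (Function.uncurry F)) (hF' : Continuous (Function.uncurry F'))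
    (h : ∀ t k, HasDerivAt (fun t => F t k) (F' t k) t) (t₀ : ℝ) :
    HasDerivAt (fun t => ∫ k, F t k ∂ν) (∫ k, F' t₀ k ∂ν) t₀ := by
  have hc : IsCompact (Metric.closedBall t₀ 1 ×ˢ (Set.univ : Set K)) :=
    (isCompact_closedBall _ _).prod isCompact_univ
  obtain ⟨C, hC⟩ := (hc.image hF').isBounded.exists_norm_le
  refine (hasDerivAt_integral_of_dominated_loc_of_deriv_le (bound := fun _ => C)
    (Metric.closedBall_mem_nhds t₀ one_pos) ?_ ?_ ?_ ?_ (integrable_const _) ?_).2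
  · exact Eventually.of_forall fun t =>
      (hF.comp (Continuous.prodMk_right t)).aestronglyMeasurable
  · exact integrable_cont ν (hF.comp (Continuous.prodMk_right t₀))
  · exact (hF'.comp (Continuous.prodMk_right t₀)).aestronglyMeasurable
  · exact Eventually.of_forall fun k t ht => hC _ ⟨(t, k), ⟨ht, trivial⟩, rfl⟩
  · exact Eventually.of_forall fun k t _ => h t k

/-- Laplace principle on a compact space. -/
lemma laplace (ν : Measure K) [IsFiniteMeasure ν] [ν.IsOpenPosMeasure] (h : K → ℝ)
    (hh : Continuous h) (h0 : ∀ k, 0 ≤ h k) (k₀ : K) (hk : h k₀ = 0)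
    (g : ℝ → K → ℝ) (hg : Continuous (Function.uncurry g)) (c : ℝ)
    (hgc : ∀ k, h k = 0 → g 0 k = c) :
    Tendsto (fun s : ℝ => (∫ k, Real.exp (-(s * h k)) * g s⁻¹ k ∂ν) /
      (∫ k, Real.exp (-(s * h k)) ∂ν)) atTop (𝓝 c) := by
  have hZi : ∀ s : ℝ, Continuous (fun k => Real.exp (-(s * h k))) := fun s => by fun_prop
  have hgs : ∀ s : ℝ, Continuous (g s) := fun s => hg.comp (Continuous.prodMk_right s)
  rw [Metric.tendsto_atTop]
  intro ε hε
  -- compact set where g is far from c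
  have hcomp : IsCompact (Set.Icc (0:ℝ) 1 ×ˢ (Set.univ : Set K)) :=
    isCompact_Icc.prod isCompact_univ
  obtain ⟨M, hM⟩ := (hcomp.image hg).isBounded.exists_norm_le
  have hT : IsCompact ((Set.Icc (0:ℝ) 1 ×ˢ (Set.univ : Set K)) ∩
      {p | ε / 2 ≤ |Function.uncurry g p - c|}) :=
    hcomp.inter_right (isClosed_le continuous_const (by fun_prop))
  obtain ⟨η, hη, hηT⟩ : ∃ η > 0, ∀ s ∈ Set.Icc (0:ℝ) 1, ∀ k, s < η → h k < η →
      |g s k - c| < ε / 2 := by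
    rcases Set.eq_empty_or_nonempty ((Set.Icc (0:ℝ) 1 ×ˢ (Set.univ : Set K)) ∩
      {p | ε / 2 ≤ |Function.uncurry g p - c|}) with he | hne
    · refine ⟨1, one_pos, fun s hs k _ _ => ?_⟩
      by_contra hcon
      have : ((s, k) : ℝ × K) ∈ (∅ : Set (ℝ × K)) := he ▸ ⟨⟨hs, trivial⟩, not_lt.mp hcon⟩
      exact this
    · obtain ⟨p, hp, hmin⟩ := hT.exists_isMinOn hne
        (f := fun p : ℝ × K => max p.1 (h p.2)) (by fun_prop)
      refine ⟨max p.1 (h p.2), ?_, fun s hs k h1 h2 => ?_⟩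
      · by_contra hcon
        have h1 : p.1 ≤ 0 := (le_max_left _ _).trans (not_lt.mp hcon)
        have h2 : h p.2 ≤ 0 := (le_max_right _ _).trans (not_lt.mp hcon)
        have h3 : p.1 = 0 := le_antisymm h1 hp.1.1.1
        have h4 : h p.2 = 0 := le_antisymm h2 (h0 _)
        have h5 := hgc _ h4
        have h6 : ε / 2 ≤ |g p.1 p.2 - c| := hp.2
        rw [h3, h5] at h6
        simp at h6
        linarith
      · by_contra hcon
        have := hmin (show ((s, k) : ℝ × K) ∈ _ from ⟨⟨hs, trivial⟩, not_lt.mp hcon⟩)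
        simp only [Set.mem_ofPred_eq] at this
        exact absurd (max_lt h1 h2) (not_lt.mpr this)
  set V : Set K := {k | h k < η / 2} with hV
  have hVo : IsOpen V := isOpen_lt hh continuous_const
  have hVpos : 0 < ν.real V := by
    rw [measureReal_def]
    refine ENNReal.toReal_pos ?_ (measure_ne_top _ _)
    exact (hVo.measure_pos ν ⟨k₀, by simp only [hV, Set.mem_ofPred_eq, hk]; linarith⟩).ne'
  -- lower bound on the normalisation
  have hZ : ∀ s : ℝ, 0 ≤ s → Real.exp (-(s * (η / 2))) * ν.real V ≤
      ∫ k, Real.exp (-(s * h k)) ∂ν := by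
    intro s hs
    calc Real.exp (-(s * (η / 2))) * ν.real V
        = ∫ k, V.indicator (fun _ => Real.exp (-(s * (η / 2)))) k ∂ν := by
          rw [integral_indicator_const _ hVo.measurableSet]; simp [mul_comm]
      _ ≤ _ := by
          refine integral_mono ((integrable_const _).indicator hVo.measurableSet)
            (integrable_cont ν (hZi s)) fun k => ?_
          by_cases hkV : k ∈ V
          · simp only [Set.indicator_of_mem hkV]
            have : h k < η / 2 := hkV
            apply Real.exp_le_exp.mpr
            nlinarith
          · simp only [Set.indicator_of_notMem hkV]
            positivity
  -- tail
  have hlim : Tendsto (fun s : ℝ => (M + |c|) * ν.real Set.univ / ν.real V *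
      Real.exp (-(s * (η / 2)))) atTop (𝓝 0) := by
    have : Tendsto (fun s : ℝ => Real.exp (-(s * (η / 2)))) atTop (𝓝 0) :=
      Real.tendsto_exp_neg_atTop_nhds_zero.comp
        (tendsto_id.atTop_mul_const (by positivity))
    simpa using this.const_mul ((M + |c|) * ν.real Set.univ / ν.real V)
  obtain ⟨S, hS⟩ := (((tendsto_order.1 hlim).2 (ε / 2) (by positivity)).and
    (eventually_gt_atTop (max 1 (1 / η)))).exists_forall_of_atTop
  refine ⟨S, fun s hs => ?_⟩
  obtain ⟨hs1, hs2⟩ := hS s hs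
  have hs3 : 1 < s := (le_max_left _ _).trans_lt hs2
  have hs4 : 1 / η < s := (le_max_right _ _).trans_lt hs2
  have hsinv : s⁻¹ ∈ Set.Icc (0:ℝ) 1 := ⟨by positivity, inv_le_one_of_one_le₀ hs3.le⟩
  have hsη : s⁻¹ < η := by
    rw [inv_lt_comm₀ (by positivity) hη]; simpa using hs4
  have hM0 : 0 ≤ M := (norm_nonneg _).trans (hM _ ⟨(s⁻¹, k₀), ⟨hsinv, trivial⟩, rfl⟩)
  set Z := ∫ k, Real.exp (-(s * h k)) ∂ν with hZdef
  have hZs := hZ s (by linarith)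
  have hZpos : 0 < Z := lt_of_lt_of_le (by positivity) hZs
  rw [Real.dist_eq]
  have e1 : (∫ k, Real.exp (-(s * h k)) * g s⁻¹ k ∂ν) / Z - c
      = (∫ k, Real.exp (-(s * h k)) * (g s⁻¹ k - c) ∂ν) / Z := by
    have : (∫ k, Real.exp (-(s * h k)) * (g s⁻¹ k - c) ∂ν)
        = (∫ k, Real.exp (-(s * h k)) * g s⁻¹ k ∂ν) - Z * c := by
      rw [hZdef, ← integral_mul_const, ← integral_sub]
      · simp only [mul_sub]
      · exact integrable_cont ν ((hZi s).mul (hgs _))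
      · exact integrable_cont ν ((hZi s).mul continuous_const)
    rw [this]; field_simp
  rw [e1, abs_div, abs_of_pos hZpos, div_lt_iff₀ hZpos]
  have e2 : |∫ k, Real.exp (-(s * h k)) * (g s⁻¹ k - c) ∂ν| ≤
      ∫ k, (ε / 2 * Real.exp (-(s * h k)) + (M + |c|) * Real.exp (-(s * η))) ∂ν := by
    refine (abs_integral_le_integral_abs).trans ?_
    refine integral_mono (integrable_cont ν (by
      exact ((hZi s).mul ((hgs _).sub continuous_const)).abs))
      (integrable_cont ν (by fun_prop)) fun k => ?_
    simp only
    rw [abs_mul, abs_of_pos (Real.exp_pos _)]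
    by_cases hkη : h k < η
    · have h1 := hηT _ hsinv k hsη hkη
      have h2 : 0 ≤ (M + |c|) * Real.exp (-(s * η)) := by positivity
      nlinarith [Real.exp_pos (-(s * h k))]
    · have h1 : |g s⁻¹ k - c| ≤ M + |c| := by
        refine (abs_sub _ _).trans (add_le_add ?_ le_rfl)
        exact hM _ ⟨(s⁻¹, k), ⟨hsinv, trivial⟩, rfl⟩
      have h2 : Real.exp (-(s * h k)) ≤ Real.exp (-(s * η)) := by
        apply Real.exp_le_exp.mpr
        push Not at hkη
        nlinarith
      have h3 : 0 ≤ ε / 2 * Real.exp (-(s * h k)) := by positivity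
      calc _ ≤ Real.exp (-(s * η)) * (M + |c|) :=
            mul_le_mul h2 h1 (abs_nonneg _) (Real.exp_pos _).le
        _ ≤ _ := by linarith
  have e3 : ∫ k, (ε / 2 * Real.exp (-(s * h k)) + (M + |c|) * Real.exp (-(s * η))) ∂ν
      = ε / 2 * Z + (M + |c|) * Real.exp (-(s * η)) * ν.real Set.univ := by
    rw [integral_add (integrable_cont ν (by fun_prop)) (integrable_const _), integral_const_mul,
      integral_const, smul_eq_mul, mul_comm (ν.real _)]
  have e4 : (M + |c|) * Real.exp (-(s * η)) * ν.real Set.univ < ε / 2 * Z := by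
    have : Real.exp (-(s * η)) = Real.exp (-(s * (η / 2))) * Real.exp (-(s * (η / 2))) := by
      rw [← Real.exp_add]; congr 1; ring
    have h5 : (M + |c|) * ν.real Set.univ * Real.exp (-(s * (η / 2))) < ε / 2 * ν.real V := by
      have := hs1
      rw [div_mul_eq_mul_div, div_lt_iff₀ hVpos] at this
      exact this
    calc _ = ((M + |c|) * ν.real Set.univ * Real.exp (-(s * (η / 2)))) *
          Real.exp (-(s * (η / 2))) := by rw [this]; ring
      _ < (ε / 2 * ν.real V) * Real.exp (-(s * (η / 2))) :=
          mul_lt_mul_of_pos_right h5 (Real.exp_pos _)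
      _ = ε / 2 * (Real.exp (-(s * (η / 2))) * ν.real V) := by ring
      _ ≤ _ := mul_le_mul_of_nonneg_left hZs (by positivity)
  linarith

end generic

lemma integral_inv_UG {N : ℕ} [MeasurableSpace (UG N)] [BorelSpace (UG N)]
    (ν : Measure (UG N)) [ν.IsHaarMeasure] [IsProbabilityMeasure ν] (f : UG N → ℝ)
    (hf : Continuous f) : ∫ U, f U⁻¹ ∂ν = ∫ U, f U ∂ν := by
  have h1 : ∫ U, (∫ V, f (U⁻¹ * V) ∂ν) ∂ν = ∫ U, f U ∂ν := by
    simp_rw [integral_mul_left_eq_self]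
    simp
  have h2 : ∫ V, (∫ U, f (U⁻¹ * V) ∂ν) ∂ν = ∫ U, f U⁻¹ ∂ν := by
    have : ∀ V : UG N, ∫ U, f (U⁻¹ * V) ∂ν = ∫ U, f U⁻¹ ∂ν := by
      intro V
      rw [← integral_mul_left_eq_self (fun U => f U⁻¹) V⁻¹]
      simp
    simp_rw [this]
    simp
  rw [← h1, ← h2, integral_integral_swap]
  have hc : Continuous (Function.uncurry fun (V U : UG N) => f (U⁻¹ * V)) := by
    unfold Function.uncurry
    exact hf.comp (by fun_prop)
  exact integrable_cont _ hc

section haar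

variable {N : ℕ}

noncomputable def dg (y : Fin N → ℝ) (U : UG N) (i : Fin N) : ℝ :=
  ∑ j, y j * Complex.normSq (U.1 i j)

noncomputable def rho (y : Fin N → ℝ) (U : UG N) (i k : Fin N) : ℝ :=
  ∑ j, y j * ((U.1 i j).re * (U.1 k j).re + (U.1 i j).im * (U.1 k j).im)

noncomputable def sig (y : Fin N → ℝ) (U : UG N) (i k : Fin N) : ℝ :=
  ∑ j, y j * ((U.1 i j).im * (U.1 k j).re - (U.1 i j).re * (U.1 k j).im)

lemma continuous_entry (i j : Fin N) : Continuous (fun U : UG N => U.1 i j) :=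
  (continuous_subtype_val).matrix_elem i j

variable {T : Type*} [TopologicalSpace T]

@[fun_prop]
lemma continuous_dg (y : Fin N → ℝ) (i : Fin N) {f : T → UG N} (hf : Continuous f) :
    Continuous (fun t => dg y (f t) i) := by
  unfold dg
  refine continuous_finsetSum _ fun j _ => continuous_const.mul ?_
  exact Complex.continuous_normSq.comp ((continuous_entry i j).comp hf)

@[fun_prop]
lemma continuous_rho (y : Fin N → ℝ) (i k : Fin N) {f : T → UG N} (hf : Continuous f) :
    Continuous (fun t => rho y (f t) i k) := by
  unfold rho
  refine continuous_finsetSum _ fun j _ => continuous_const.mul ?_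
  have h1 := (continuous_entry i j).comp hf
  have h2 := (continuous_entry k j).comp hf
  exact ((Complex.continuous_re.comp h1).mul (Complex.continuous_re.comp h2)).add
    ((Complex.continuous_im.comp h1).mul (Complex.continuous_im.comp h2))

@[fun_prop]
lemma continuous_sig (y : Fin N → ℝ) (i k : Fin N) {f : T → UG N} (hf : Continuous f) :
    Continuous (fun t => sig y (f t) i k) := by
  unfold sig
  refine continuous_finsetSum _ fun j _ => continuous_const.mul ?_
  have h1 := (continuous_entry i j).comp hf
  have h2 := (continuous_entry k j).comp hf
  exact ((Complex.continuous_im.comp h1).mul (Complex.continuous_re.comp h2)).sub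
    ((Complex.continuous_re.comp h1).mul (Complex.continuous_im.comp h2))

noncomputable def dot (x d : Fin N → ℝ) : ℝ := ∑ a, x a * d a

@[fun_prop]
lemma continuous_dot {x d : T → Fin N → ℝ} (hx : Continuous x) (hd : Continuous d) :
    Continuous (fun t => dot (x t) (d t)) := by
  unfold dot; fun_prop

@[fun_prop]
lemma continuous_dgv (y : Fin N → ℝ) {f : T → UG N} (hf : Continuous f) :
    Continuous (fun t => dg y (f t)) :=
  continuous_pi fun i => continuous_dg y i hf

/-- Rotation matrix in the `(i,k)` plane. -/
noncomputable def rotM (i k : Fin N) (t : ℝ) : Matrix (Fin N) (Fin N) ℂ := fun a b =>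
  if a = i then (if b = i then (Real.cos t : ℂ) else if b = k then -(Real.sin t : ℂ) else 0)
  else if a = k then (if b = i then (Real.sin t : ℂ) else if b = k then (Real.cos t : ℂ) else 0)
  else if b = a then 1 else 0

lemma rotM_sum {i k : Fin N} (hik : i ≠ k) (t : ℝ) (a : Fin N) (f : Fin N → ℂ) :
    ∑ b, rotM i k t a b * f b =
      if a = i then (Real.cos t : ℂ) * f i - (Real.sin t : ℂ) * f k
      else if a = k then (Real.sin t : ℂ) * f i + (Real.cos t : ℂ) * f k else f a := by
  have key : ∀ p q : ℂ, ∑ b, (if b = i then p else if b = k then q else 0) * f b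
      = p * f i + q * f k := by
    intro p q
    have : ∀ b, (if b = i then p else if b = k then q else 0) * f b
        = (if b = i then p * f b else 0) + (if b = k then q * f b else 0) := by
      intro b
      by_cases h1 : b = i
      · subst h1; simp [hik]
      · by_cases h2 : b = k
        · subst h2; simp [hik.symm]
        · simp [h1, h2]
    simp_rw [this, Finset.sum_add_distrib]
    simp
  unfold rotM
  by_cases h1 : a = i
  · simp only [h1, if_true]
    rw [key]; ring
  · by_cases h2 : a = k
    · simp only [h2, if_true, hik.symm, if_false]
      rw [key]
    · simp [h1, h2]

lemma rotM_mem {i k : Fin N} (hik : i ≠ k) (t : ℝ) :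
    rotM i k t ∈ Matrix.unitaryGroup (Fin N) ℂ := by
  rw [Matrix.mem_unitaryGroup_iff]
  ext a b
  rw [Matrix.mul_apply, rotM_sum hik]
  have hcs : (Real.cos t : ℂ) * Real.cos t + (Real.sin t : ℂ) * Real.sin t = 1 := by
    have := Real.cos_sq_add_sin_sq t
    have h2 : ((Real.cos t ^ 2 + Real.sin t ^ 2 : ℝ) : ℂ) = 1 := by rw [this]; simp
    push_cast at h2 ⊢
    rw [← h2]; ring
  simp only [Matrix.star_apply, Matrix.one_apply, rotM]
  by_cases h1 : a = i
  · by_cases h2 : b = i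
    · simp [h1, h2, hik.symm, hik, -Complex.ofReal_cos, -Complex.ofReal_sin, hcs]
    · by_cases h3 : b = k
      · simp [h1, h3, hik.symm, hik, -Complex.ofReal_cos, -Complex.ofReal_sin]; ring
      · simp [h1, h2, h3, Ne.symm h2, Ne.symm h3, eq_comm]
  · by_cases h4 : a = k
    · by_cases h2 : b = i
      · simp [h4, h2, hik.symm, hik, -Complex.ofReal_cos, -Complex.ofReal_sin]; ring
      · by_cases h3 : b = k
        · simp [h4, h3, hik.symm, hik, -Complex.ofReal_cos, -Complex.ofReal_sin]
          rw [add_comm]; exact hcs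
        · simp [h4, h2, h3, Ne.symm h2, Ne.symm h3, hik.symm]
    · by_cases h2 : b = i
      · simp [h1, h4, h2]
      · by_cases h3 : b = k
        · simp [h1, h4, h3, hik.symm]
        · simp [h1, h4, h2, h3]

noncomputable def rot {i k : Fin N} (hik : i ≠ k) (t : ℝ) : UG N := ⟨rotM i k t, rotM_mem hik t⟩

lemma rot_mul_apply {i k : Fin N} (hik : i ≠ k) (t : ℝ) (U : UG N) (a j : Fin N) :
    (rot hik t * U).1 a j =
      if a = i then (Real.cos t : ℂ) * U.1 i j - (Real.sin t : ℂ) * U.1 k j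
      else if a = k then (Real.sin t : ℂ) * U.1 i j + (Real.cos t : ℂ) * U.1 k j else U.1 a j :=
  rotM_sum hik t a (fun b => U.1 b j)

lemma dg_rot_i {i k : Fin N} (hik : i ≠ k) (t : ℝ) (y : Fin N → ℝ) (U : UG N) :
    dg y (rot hik t * U) i = Real.cos t ^ 2 * dg y U i + Real.sin t ^ 2 * dg y U k
      - 2 * Real.cos t * Real.sin t * rho y U i k := by
  simp only [dg, rho, rot_mul_apply, Finset.mul_sum, ← Finset.sum_add_distrib,
    ← Finset.sum_sub_distrib, if_true]
  refine Finset.sum_congr rfl fun j _ => ?_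
  simp only [Complex.normSq_apply, Complex.sub_re, Complex.sub_im, Complex.re_ofReal_mul,
    Complex.im_ofReal_mul]
  ring

lemma dg_rot_k {i k : Fin N} (hik : i ≠ k) (t : ℝ) (y : Fin N → ℝ) (U : UG N) :
    dg y (rot hik t * U) k = Real.sin t ^ 2 * dg y U i + Real.cos t ^ 2 * dg y U k
      + 2 * Real.cos t * Real.sin t * rho y U i k := by
  simp only [dg, rho, rot_mul_apply, Finset.mul_sum, ← Finset.sum_add_distrib,
    ← Finset.sum_sub_distrib, if_true, hik.symm, if_false]
  refine Finset.sum_congr rfl fun j _ => ?_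
  simp only [Complex.normSq_apply, Complex.add_re, Complex.add_im, Complex.re_ofReal_mul,
    Complex.im_ofReal_mul]
  ring

lemma dg_rot_other {i k a : Fin N} (hik : i ≠ k) (t : ℝ) (y : Fin N → ℝ) (U : UG N)
    (h1 : a ≠ i) (h2 : a ≠ k) :
    dg y (rot hik t * U) a = dg y U a := by
  simp only [dg, rot_mul_apply, h1, h2, if_false]

lemma rho_rot {i k : Fin N} (hik : i ≠ k) (t : ℝ) (y : Fin N → ℝ) (U : UG N) :
    rho y (rot hik t * U) i k = Real.cos t * Real.sin t * (dg y U i - dg y U k)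
      + (Real.cos t ^ 2 - Real.sin t ^ 2) * rho y U i k := by
  simp only [dg, rho, rot_mul_apply, Finset.mul_sum, ← Finset.sum_add_distrib,
    ← Finset.sum_sub_distrib, if_true, hik.symm, if_false]
  refine Finset.sum_congr rfl fun j _ => ?_
  simp only [Complex.normSq_apply, Complex.add_re, Complex.add_im, Complex.re_ofReal_mul,
    Complex.im_ofReal_mul, Complex.sub_re, Complex.sub_im]
  ring

lemma dot_rot {i k : Fin N} (hik : i ≠ k) (t : ℝ) (x y : Fin N → ℝ) (U : UG N) :
    dot x (dg y (rot hik t * U)) = dot x (dg y U) + (x i - x k) *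
      (Real.sin t ^ 2 * (dg y U k - dg y U i) - 2 * Real.cos t * Real.sin t * rho y U i k) := by
  have hd : dot x (dg y (rot hik t * U)) - dot x (dg y U) =
      ∑ a, x a * (dg y (rot hik t * U) a - dg y U a) := by
    simp only [dot, ← Finset.sum_sub_distrib, mul_sub]
  have h2 : ∑ a, x a * (dg y (rot hik t * U) a - dg y U a)
      = x i * (dg y (rot hik t * U) i - dg y U i) + x k * (dg y (rot hik t * U) k - dg y U k) := by
    rw [Finset.sum_eq_add i k hik]
    · intro c _ hc
      rw [dg_rot_other hik t y U hc.1 hc.2]; simp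
    · simp
    · simp
  rw [h2, dg_rot_i, dg_rot_k] at hd
  have hcs : Real.cos t ^ 2 = 1 - Real.sin t ^ 2 := by
    linarith [Real.sin_sq_add_cos_sq t]
  rw [hcs] at hd
  linarith

/-- phase matrix -/
noncomputable def phase (i : Fin N) : UG N :=
  ⟨Matrix.diagonal (fun a => if a = i then Complex.I else 1), by
    rw [Matrix.mem_unitaryGroup_iff, Matrix.star_eq_conjTranspose, Matrix.diagonal_conjTranspose,
      Matrix.diagonal_mul_diagonal, ← Matrix.diagonal_one]
    congr 1
    ext a
    by_cases h : a = i <;> simp [h]⟩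

lemma phase_mul_apply (i : Fin N) (U : UG N) (a j : Fin N) :
    (phase i * U).1 a j = (if a = i then Complex.I else 1) * U.1 a j := by
  change (Matrix.diagonal (fun a => if a = i then Complex.I else (1:ℂ)) *
    (U.1 : Matrix (Fin N) (Fin N) ℂ)) a j = _
  rw [Matrix.diagonal_mul]

lemma dg_phase (i : Fin N) (y : Fin N → ℝ) (U : UG N) : dg y (phase i * U) = dg y U := by
  ext a
  simp only [dg, phase_mul_apply, Complex.normSq_mul]
  by_cases h : a = i <;> simp [h]

lemma rho_phase {i k : Fin N} (hik : i ≠ k) (y : Fin N → ℝ) (U : UG N) :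
    rho y (phase i * U) i k = - sig y U i k := by
  simp only [rho, sig, phase_mul_apply, ← Finset.sum_neg_distrib, hik.symm, if_true, if_false]
  refine Finset.sum_congr rfl fun j _ => ?_
  simp
  ring

variable [MeasurableSpace (UG N)] [BorelSpace (UG N)]
    (ν : Measure (UG N)) [ν.IsHaarMeasure] [IsProbabilityMeasure ν]

lemma haar_pair_re {i k : Fin N} (hik : i ≠ k) (x y : Fin N → ℝ) :
    ∫ U, Real.exp (dot x (dg y U)) * ((dg y U i - dg y U k) -
      2 * (x i - x k) * rho y U i k ^ 2) ∂ν = 0 := by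
  set F : ℝ → UG N → ℝ := fun t U => Real.exp (dot x (dg y U) + (x i - x k) *
      (Real.sin t ^ 2 * (dg y U k - dg y U i) - 2 * Real.cos t * Real.sin t * rho y U i k)) *
    (Real.cos t * Real.sin t * (dg y U i - dg y U k)
      + (Real.cos t ^ 2 - Real.sin t ^ 2) * rho y U i k) with hF
  set F' : ℝ → UG N → ℝ := fun t U =>
    (Real.exp (dot x (dg y U) + (x i - x k) *
      (Real.sin t ^ 2 * (dg y U k - dg y U i) - 2 * Real.cos t * Real.sin t * rho y U i k)) *
      ((x i - x k) * (2 * Real.sin t * Real.cos t * (dg y U k - dg y U i) -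
        2 * (Real.cos t ^ 2 - Real.sin t ^ 2) * rho y U i k))) *
    (Real.cos t * Real.sin t * (dg y U i - dg y U k)
      + (Real.cos t ^ 2 - Real.sin t ^ 2) * rho y U i k) +
    Real.exp (dot x (dg y U) + (x i - x k) *
      (Real.sin t ^ 2 * (dg y U k - dg y U i) - 2 * Real.cos t * Real.sin t * rho y U i k)) *
     ((Real.cos t ^ 2 - Real.sin t ^ 2) * (dg y U i - dg y U k)
      - 4 * Real.cos t * Real.sin t * rho y U i k) with hF'
  have hconst : ∀ t, ∫ U, F t U ∂ν = ∫ U, F 0 U ∂ν := by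
    intro t
    have h1 : ∀ t, F t = fun U => (fun V => Real.exp (dot x (dg y V)) * rho y V i k)
        (rot hik t * U) := by
      intro t
      ext U
      simp only [hF, dot_rot, rho_rot]
    rw [h1 t, h1 0, integral_mul_left_eq_self, integral_mul_left_eq_self]
  have hd := hasDerivAt_int ν F F' (by simp only [hF, Function.uncurry_def]; fun_prop)
    (by simp only [hF', Function.uncurry_def]; fun_prop) (by
      intro t U
      have hs := Real.hasDerivAt_sin t
      have hc := Real.hasDerivAt_cos t
      have h1 := ((((hs.pow 2).mul_const (dg y U k - dg y U i)).sub
        (((hc.const_mul 2).mul hs).mul_const (rho y U i k))).const_mul (x i - x k)).const_add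
        (dot x (dg y U))
      have h2 := ((hc.mul hs).mul_const (dg y U i - dg y U k)).add
        (((hc.pow 2).sub (hs.pow 2)).mul_const (rho y U i k))
      have h3 := h1.exp.mul h2
      refine h3.congr_deriv ?_
      simp only [hF', Pi.add_apply, Pi.mul_apply, Pi.sub_apply, Pi.pow_apply]
      push_cast
      ring) 0
  have hd0 : HasDerivAt (fun t => ∫ U, F t U ∂ν) 0 0 := by
    simp_rw [hconst]; exact hasDerivAt_const _ _
  have h0 := hd.unique hd0
  rw [← h0]
  refine integral_congr_ae (Eventually.of_forall fun U => ?_)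
  simp [hF']
  ring

lemma haar_pair {i k : Fin N} (hik : i ≠ k) (x y : Fin N → ℝ) :
    ∫ U, Real.exp (dot x (dg y U)) * ((dg y U i - dg y U k) -
      (x i - x k) * (rho y U i k ^ 2 + sig y U i k ^ 2)) ∂ν = 0 := by
  have h1 := haar_pair_re ν hik x y
  have h2 : ∫ U, Real.exp (dot x (dg y U)) * ((dg y U i - dg y U k) -
      2 * (x i - x k) * sig y U i k ^ 2) ∂ν = 0 := by
    rw [← h1, ← integral_mul_left_eq_self (fun U => Real.exp (dot x (dg y U)) *
      ((dg y U i - dg y U k) - 2 * (x i - x k) * rho y U i k ^ 2)) (phase i)]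
    simp only [dg_phase, rho_phase hik, neg_sq]
  have h3 : ∫ U, (Real.exp (dot x (dg y U)) * ((dg y U i - dg y U k) -
      2 * (x i - x k) * rho y U i k ^ 2) + Real.exp (dot x (dg y U)) * ((dg y U i - dg y U k) -
      2 * (x i - x k) * sig y U i k ^ 2)) ∂ν = 0 := by
    rw [integral_add (integrable_cont ν (by fun_prop)) (integrable_cont ν (by fun_prop)), h1, h2,
      add_zero]
  have h4 : ∀ U : UG N, Real.exp (dot x (dg y U)) * ((dg y U i - dg y U k) -
      (x i - x k) * (rho y U i k ^ 2 + sig y U i k ^ 2)) =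
      (1 / 2) * (Real.exp (dot x (dg y U)) * ((dg y U i - dg y U k) -
      2 * (x i - x k) * rho y U i k ^ 2) + Real.exp (dot x (dg y U)) * ((dg y U i - dg y U k) -
      2 * (x i - x k) * sig y U i k ^ 2)) := fun U => by ring
  simp_rw [h4]
  rw [integral_const_mul, h3, mul_zero]

end haar

section algebra

variable {N : ℕ}

def PP (N : ℕ) : Finset (Fin N × Fin N) := Finset.univ.filter (fun p => p.2 < p.1)

noncomputable def Dl (x : Fin N → ℝ) : ℝ := ∏ p ∈ PP N, (x p.1 - x p.2)

noncomputable def dD (d x : Fin N → ℝ) : ℝ :=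
  ∑ p ∈ PP N, (∏ q ∈ (PP N).erase p, (x q.1 - x q.2)) * (d p.1 - d p.2)

lemma Dl_eq (x : Fin N → ℝ) : Dl x = ∏ i : Fin N, ∏ j ∈ Finset.Iio i, (x i - x j) := by
  unfold Dl PP
  rw [Finset.prod_filter, ← Finset.univ_product_univ, Finset.prod_product]
  refine Finset.prod_congr rfl fun i _ => ?_
  rw [← Finset.prod_filter]
  refine Finset.prod_congr ?_ fun _ _ => rfl
  ext j; simp

lemma Dl_vander (x : Fin N → ℝ) : Dl x = (Matrix.vandermonde x).det := by
  rw [Matrix.det_vandermonde]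
  unfold Dl PP
  rw [Finset.prod_filter, ← Finset.univ_product_univ, Finset.prod_product_right]
  refine Finset.prod_congr rfl fun i _ => ?_
  rw [← Finset.prod_filter]
  refine Finset.prod_congr ?_ fun _ _ => rfl
  ext j; simp

lemma Dl_ne_zero {x : Fin N → ℝ} (hx : Function.Injective x) : Dl x ≠ 0 := by
  rw [Dl_vander]; exact Matrix.det_vandermonde_ne_zero_iff.mpr hx

lemma Dl_perm (x : Fin N → ℝ) (σ : Equiv.Perm (Fin N)) :
    Dl (x ∘ σ) = (Equiv.Perm.sign σ : ℤ) * Dl x := by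
  rw [Dl_vander, Dl_vander]
  have : Matrix.vandermonde (x ∘ σ) = (Matrix.vandermonde x).submatrix σ id := by
    ext a b; simp [Matrix.vandermonde]
  rw [this, Matrix.det_permute]
  
lemma Dl_smul (s : ℝ) (x : Fin N → ℝ) : Dl (fun i => s * x i) = s ^ (PP N).card * Dl x := by
  unfold Dl
  simp_rw [← mul_sub]
  rw [Finset.prod_mul_distrib, Finset.prod_const]

lemma hasDerivAt_Dl (x d : Fin N → ℝ) (s : ℝ) :
    HasDerivAt (fun t => Dl (fun i => x i + t * d i)) (dD d (fun i => x i + s * d i)) s := by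
  unfold Dl dD
  have := HasDerivAt.fun_finsetProd (u := PP N) (x := s)
    (f := fun p t => (x p.1 + t * d p.1) - (x p.2 + t * d p.2))
    (f' := fun p => d p.1 - d p.2) (fun p _ => by
      have h : ∀ i, HasDerivAt (fun t => x i + t * d i) (d i) s := fun i => by
        simpa using ((hasDerivAt_id s).mul_const (d i)).const_add (x i)
      exact (h p.1).sub (h p.2))
  simpa [smul_eq_mul] using this

lemma Bmat (y : Fin N → ℝ) (U : UG N) (i k : Fin N) :
    ((U.1 : Matrix (Fin N) (Fin N) ℂ) * Matrix.diagonal (fun i => (y i : ℂ)) *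
      star (U.1 : Matrix (Fin N) (Fin N) ℂ)) i k = ⟨rho y U i k, sig y U i k⟩ := by
  rw [Matrix.mul_apply]
  simp only [Matrix.mul_diagonal, Matrix.star_apply]
  apply Complex.ext
  · simp only [Complex.re_sum, rho]
    refine Finset.sum_congr rfl fun j _ => ?_
    simp; ring
  · simp only [Complex.im_sum, sig]
    refine Finset.sum_congr rfl fun j _ => ?_
    simp; ring

lemma rho_self (y : Fin N → ℝ) (U : UG N) (i : Fin N) : rho y U i i = dg y U i := by
  simp [rho, dg, Complex.normSq_apply]

lemma sig_self (y : Fin N → ℝ) (U : UG N) (i : Fin N) : sig y U i i = 0 := by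
  unfold sig
  refine Finset.sum_eq_zero fun j _ => by ring

lemma rho_symm (y : Fin N → ℝ) (U : UG N) (i k : Fin N) : rho y U i k = rho y U k i := by
  unfold rho
  refine Finset.sum_congr rfl fun j _ => by ring

lemma sig_symm (y : Fin N → ℝ) (U : UG N) (i k : Fin N) : sig y U i k = - sig y U k i := by
  unfold sig
  rw [← Finset.sum_neg_distrib]
  refine Finset.sum_congr rfl fun j _ => by ring

lemma sum_sq_full (y : Fin N → ℝ) (U : UG N) :
    ∑ i, ∑ k, (rho y U i k ^ 2 + sig y U i k ^ 2) = dot y y := by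
  set V : Matrix (Fin N) (Fin N) ℂ := U.1 with hV
  set D : Matrix (Fin N) (Fin N) ℂ := Matrix.diagonal (fun i => (y i : ℂ)) with hD
  have hDs : star D = D := by
    rw [hD, Matrix.star_eq_conjTranspose, Matrix.diagonal_conjTranspose]
    congr 1; ext a; simp
  have hu : star V * V = 1 := Matrix.mem_unitaryGroup_iff'.mp U.2
  have h1 : (V * D * star V) * star (V * D * star V) = V * (D * D) * star V := by
    simp only [star_mul, star_star, hDs]
    calc V * D * star V * (V * (D * star V)) = V * D * (star V * V) * (D * star V) := by
          simp only [mul_assoc]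
      _ = _ := by rw [hu]; simp only [mul_assoc, mul_one]; 
  have h2 : Matrix.trace (V * (D * D) * star V) = ((dot y y : ℝ) : ℂ) := by
    rw [Matrix.trace_mul_comm, ← mul_assoc, hu, one_mul, hD, Matrix.diagonal_mul_diagonal,
      Matrix.trace_diagonal, dot]
    push_cast; rfl
  rw [← h1] at h2
  have h3 : Matrix.trace ((V * D * star V) * star (V * D * star V)) =
      ((∑ i, ∑ k, (rho y U i k ^ 2 + sig y U i k ^ 2) : ℝ) : ℂ) := by
    rw [Matrix.trace]
    push_cast
    refine Finset.sum_congr rfl fun i _ => ?_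
    rw [Matrix.diag_apply, Matrix.mul_apply]
    refine Finset.sum_congr rfl fun k _ => ?_
    rw [Matrix.star_apply, hV, hD, Bmat]
    apply Complex.ext <;> simp [pow_two]
    ring
  rw [h3] at h2
  exact_mod_cast h2

lemma sum_pairs (f : Fin N → Fin N → ℝ) (hf : ∀ i k, f i k = f k i) :
    ∑ i, ∑ k, f i k = ∑ i, f i i + 2 * ∑ p ∈ PP N, f p.1 p.2 := by
  have h1 : ∑ p ∈ PP N, f p.1 p.2 = ∑ i, ∑ k, if k < i then f i k else 0 := by
    unfold PP
    rw [Finset.sum_filter, ← Finset.univ_product_univ, Finset.sum_product]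
  have h2 : ∑ p ∈ PP N, f p.1 p.2 = ∑ i, ∑ k, if i < k then f i k else 0 := by
    rw [h1, Finset.sum_comm]
    refine Finset.sum_congr rfl fun i _ => Finset.sum_congr rfl fun k _ => ?_
    rw [hf]
  have h3 : ∑ i, f i i = ∑ i, ∑ k, if i = k then f i k else 0 := by
    refine Finset.sum_congr rfl fun i _ => ?_
    simp
  rw [two_mul, h3]
  nth_rewrite 1 [h1]
  rw [h2, ← Finset.sum_add_distrib, ← Finset.sum_add_distrib]
  refine Finset.sum_congr rfl fun i _ => ?_
  rw [← Finset.sum_add_distrib, ← Finset.sum_add_distrib]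
  refine Finset.sum_congr rfl fun k _ => ?_
  rcases lt_trichotomy i k with h | h | h
  · simp [h, h.ne, h.not_gt]
  · simp [h]
  · simp [h, h.ne', h.not_gt]

lemma sum_sq (y : Fin N → ℝ) (U : UG N) :
    dot y y = dot (dg y U) (dg y U)
      + 2 * ∑ p ∈ PP N, (rho y U p.1 p.2 ^ 2 + sig y U p.1 p.2 ^ 2) := by
  rw [← sum_sq_full y U, sum_pairs (fun i k => rho y U i k ^ 2 + sig y U i k ^ 2)
    (fun i k => by rw [rho_symm, sig_symm]; ring)]
  simp [rho_self, sig_self, dot, pow_two]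

@[fun_prop]
lemma continuous_Dl {T : Type*} [TopologicalSpace T] {x : T → Fin N → ℝ} (hx : Continuous x) :
    Continuous (fun t => Dl (x t)) := by
  unfold Dl; fun_prop

@[fun_prop]
lemma continuous_dD {T : Type*} [TopologicalSpace T] {d x : T → Fin N → ℝ} (hd : Continuous d)
    (hx : Continuous x) :
    Continuous (fun t => dD (d t) (x t)) := by
  unfold dD; fun_prop

variable [MeasurableSpace (UG N)] [BorelSpace (UG N)]
    (ν : Measure (UG N)) [ν.IsHaarMeasure] [IsProbabilityMeasure ν]

lemma P3 (x y : Fin N → ℝ) :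
    ∫ U, Real.exp (dot x (dg y U)) * ((1/2) * (dot (dg y U) (dg y U) - dot y y) * Dl x
      + dD (dg y U) x) ∂ν = 0 := by
  have h1 : ∀ U : UG N, Real.exp (dot x (dg y U)) *
      ((1/2) * (dot (dg y U) (dg y U) - dot y y) * Dl x + dD (dg y U) x)
      = ∑ p ∈ PP N, (∏ q ∈ (PP N).erase p, (x q.1 - x q.2)) * (Real.exp (dot x (dg y U)) *
        ((dg y U p.1 - dg y U p.2) -
        (x p.1 - x p.2) * (rho y U p.1 p.2 ^ 2 + sig y U p.1 p.2 ^ 2))) := by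
    intro U
    have e1 : (1/2) * (dot (dg y U) (dg y U) - dot y y) * Dl x =
        - ∑ p ∈ PP N, (∏ q ∈ (PP N).erase p, (x q.1 - x q.2)) * (x p.1 - x p.2) *
          (rho y U p.1 p.2 ^ 2 + sig y U p.1 p.2 ^ 2) := by
      rw [sum_sq y U]
      have : ∀ p ∈ PP N, (∏ q ∈ (PP N).erase p, (x q.1 - x q.2)) * (x p.1 - x p.2) *
          (rho y U p.1 p.2 ^ 2 + sig y U p.1 p.2 ^ 2) =
          Dl x * (rho y U p.1 p.2 ^ 2 + sig y U p.1 p.2 ^ 2) := by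
        intro p hp
        rw [Finset.prod_erase_mul (PP N) (fun q => x q.1 - x q.2) hp]
        rfl
      rw [Finset.sum_congr rfl this, ← Finset.mul_sum]
      ring
    rw [e1, dD, ← Finset.sum_neg_distrib, ← Finset.sum_add_distrib, Finset.mul_sum]
    refine Finset.sum_congr rfl fun p _ => by ring
  simp_rw [h1]
  rw [integral_finsetSum]
  · refine Finset.sum_eq_zero fun p hp => ?_
    rw [integral_const_mul, haar_pair ν, mul_zero]
    have : p.2 < p.1 := by simpa [PP] using hp
    exact this.ne'
  · intro p _
    exact integrable_cont ν (by fun_prop)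

end algebra

section gauss

open ProbabilityTheory
open scoped NNReal

lemma gauss_shift {v : ℝ≥0} (hv : v ≠ 0) (d : ℝ) (f : ℝ → ℝ) :
    ∫ u, Real.exp (u * d) * f u ∂(gaussianReal 0 v) =
      Real.exp (v * d ^ 2 / 2) * ∫ u, f (v * d + u) ∂(gaussianReal 0 v) := by
  rw [integral_gaussianReal_eq_integral_smul hv, integral_gaussianReal_eq_integral_smul hv,
    ← integral_add_left_eq_self (fun u => gaussianPDFReal 0 v u • (Real.exp (u * d) * f u)) (v * d),
    ← integral_const_mul]
  congr 1
  ext u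
  simp only [gaussianPDFReal_def, smul_eq_mul]
  have hv' : (v : ℝ) ≠ 0 := by exact_mod_cast hv
  have : Real.exp (-(v * d + u - 0) ^ 2 / (2 * v)) * Real.exp ((v * d + u) * d) =
      Real.exp (v * d ^ 2 / 2) * Real.exp (-(u - 0) ^ 2 / (2 * v)) := by
    rw [← Real.exp_add, ← Real.exp_add]
    congr 1
    field_simp
    ring
  linear_combination ((√(2 * Real.pi * v))⁻¹ * f (v * d + u)) * this

lemma gauss_int_pow_exp (v : ℝ≥0) (t : ℝ) (n : ℕ) :
    Integrable (fun u : ℝ => u ^ n * Real.exp (t * u)) (gaussianReal 0 v) := by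
  have := integrable_pow_mul_exp_of_mem_interior_integrableExpSet (X := id)
    (μ := gaussianReal 0 v) (v := t) (by rw [integrableExpSet_id_gaussianReal]; simp) n
  simpa using this

lemma gauss_int_apow_exp (v : ℝ≥0) (t a : ℝ) (n : ℕ) :
    Integrable (fun u : ℝ => Real.exp (u * t) * (a + u) ^ n) (gaussianReal 0 v) := by
  have h : (fun u : ℝ => Real.exp (u * t) * (a + u) ^ n) = fun u => ∑ m ∈ Finset.range (n + 1),
      (a ^ m * n.choose m) * (u ^ (n - m) * Real.exp (t * u)) := by
    ext u
    rw [add_pow, Finset.mul_sum, mul_comm u t]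
    refine Finset.sum_congr rfl fun m _ => by ring
  rw [h]
  exact integrable_finsetSum _ fun m _ => (gauss_int_pow_exp v t (n - m)).const_mul _

noncomputable def Hp (v : ℝ≥0) (k : ℕ) : Polynomial ℝ :=
  ∑ m ∈ Finset.range (k + 1),
    Polynomial.C (k.choose m * ∫ u, u ^ (k - m) ∂(gaussianReal 0 v)) * Polynomial.X ^ m

lemma Hp_eq (v : ℝ≥0) (k : ℕ) : ∃ q : Polynomial ℝ, q.degree < k ∧
    Hp v k = Polynomial.X ^ k + q := by
  refine ⟨∑ m ∈ Finset.range k,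
    Polynomial.C (k.choose m * ∫ u, u ^ (k - m) ∂(gaussianReal 0 v)) * Polynomial.X ^ m, ?_, ?_⟩
  · rw [Finset.sum_range]
    exact Polynomial.degree_sum_fin_lt
      (fun m : Fin k => ((k.choose m : ℝ) * ∫ u, u ^ (k - m : ℕ) ∂(gaussianReal 0 v)))
  · rw [Hp, Finset.sum_range_succ, add_comm]
    simp

lemma Hp_natDegree (v : ℝ≥0) (k : ℕ) : (Hp v k).natDegree = k := by
  obtain ⟨q, hq, h⟩ := Hp_eq v k
  rw [h]
  have := Polynomial.degree_add_eq_left_of_degree_lt (p := Polynomial.X ^ k) (q := q)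
    (by rw [Polynomial.degree_X_pow]; exact hq)
  rw [Polynomial.natDegree, this, Polynomial.degree_X_pow]; rfl

lemma Hp_monic (v : ℝ≥0) (k : ℕ) : (Hp v k).Monic := by
  obtain ⟨q, hq, h⟩ := Hp_eq v k
  rw [h]
  exact Polynomial.monic_X_pow_add hq

lemma Hp_eval (v : ℝ≥0) (k : ℕ) (a : ℝ) :
    (Hp v k).eval a = ∫ u, (a + u) ^ k ∂(gaussianReal 0 v) := by
  simp_rw [add_pow]
  rw [integral_finsetSum]
  · rw [Hp, Polynomial.eval_finsetSum]
    refine Finset.sum_congr rfl fun m _ => ?_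
    rw [integral_mul_const, integral_const_mul]
    simp
    ring
  · intro m _
    have := gauss_int_pow_exp v 0 (k - m)
    simp only [zero_mul, Real.exp_zero, mul_one] at this
    exact (this.const_mul _).mul_const _

variable {N : ℕ}

noncomputable def gam (N : ℕ) (v : ℝ≥0) : Measure (Fin N → ℝ) :=
  Measure.pi (fun _ => gaussianReal 0 v)

instance (N : ℕ) (v : ℝ≥0) : IsProbabilityMeasure (gam N v) := by
  unfold gam; infer_instance

lemma gam_Dl {v : ℝ≥0} (hv : v ≠ 0) (a d : Fin N → ℝ) :
    ∫ u, Real.exp (dot u d) * Dl (fun i => a i + u i) ∂(gam N v) =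
      Real.exp (v * dot d d / 2) * Dl (fun i => a i + v * d i) := by
  have hexp : ∀ u : Fin N → ℝ, Real.exp (dot u d) = ∏ i, Real.exp (u i * d i) := fun u => by
    rw [dot, Real.exp_sum]
  have hexp2 : Real.exp (v * dot d d / 2) = ∏ i, Real.exp (v * d i ^ 2 / 2) := by
    rw [← Real.exp_sum, dot, Finset.mul_sum, Finset.sum_div]
    congr 1
    refine Finset.sum_congr rfl fun i _ => by ring
  have h1 : ∀ u : Fin N → ℝ, Real.exp (dot u d) * Dl (fun i => a i + u i) =
      ∑ σ : Equiv.Perm (Fin N), ((Equiv.Perm.sign σ : ℤ) : ℝ) *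
        ∏ i, (Real.exp (u i * d i) * (a i + u i) ^ (σ i : ℕ)) := by
    intro u
    rw [hexp, Dl_vander, ← Matrix.det_transpose, Matrix.det_apply', Finset.mul_sum]
    refine Finset.sum_congr rfl fun σ _ => ?_
    rw [Finset.prod_mul_distrib]
    simp [Matrix.vandermonde_apply]
    ring
  simp_rw [h1]
  rw [integral_finsetSum]
  · simp_rw [integral_const_mul, gam]
    have h2 : ∀ σ : Equiv.Perm (Fin N), ∫ u, ∏ i, (Real.exp (u i * d i) * (a i + u i) ^ (σ i : ℕ))
        ∂(Measure.pi (fun _ : Fin N => gaussianReal 0 v)) =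
        ∏ i, (Real.exp (v * d i ^ 2 / 2) * (Hp v (σ i)).eval (a i + v * d i)) := by
      intro σ
      rw [integral_fintype_prod_eq_prod
        (fun i (u : ℝ) => Real.exp (u * d i) * (a i + u) ^ (σ i : ℕ))]
      refine Finset.prod_congr rfl fun i _ => ?_
      rw [gauss_shift hv, Hp_eval]
      simp_rw [add_assoc]
    simp_rw [h2, Finset.prod_mul_distrib]
    rw [Dl_vander, Matrix.det_eval_matrixOfPolynomials_eq_det_vandermonde _ (fun i => Hp v i)
      (fun i => Hp_natDegree v i) (fun i => Hp_monic v i), ← Matrix.det_transpose,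
      Matrix.det_apply', hexp2, Finset.mul_sum]
    refine Finset.sum_congr rfl fun σ _ => ?_
    simp [Matrix.of_apply]
    ring
  · intro σ _
    refine Integrable.const_mul ?_ _
    exact Integrable.fintype_prod
      (f := fun i (u : ℝ) => Real.exp (u * d i) * (a i + u) ^ (σ i : ℕ))
      (fun i => gauss_int_apow_exp v _ _ _)

/-- derivative as a finite combination of values -/
lemma dD_comb (N : ℕ) : ∃ c : ℕ → ℝ, ∀ x d : Fin N → ℝ,
    dD d x = ∑ j ∈ Finset.range ((PP N).card + 1), c j * Dl (fun i => x i + j * d i) := by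
  refine ⟨fun j => (Lagrange.basis (Finset.range ((PP N).card + 1))
    (fun j : ℕ => (j : ℝ)) j).derivative.eval 0, fun x d => ?_⟩
  set p : Polynomial ℝ := ∏ q ∈ PP N, (Polynomial.C (x q.1 - x q.2) +
    Polynomial.C (d q.1 - d q.2) * Polynomial.X) with hp
  have hpe : ∀ t, p.eval t = Dl (fun i => x i + t * d i) := by
    intro t
    rw [hp, Polynomial.eval_prod, Dl]
    refine Finset.prod_congr rfl fun q _ => ?_
    simp
    ring
  have hdeg : p.degree < (Finset.range ((PP N).card + 1)).card := by
    rw [Finset.card_range]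
    refine lt_of_le_of_lt Polynomial.degree_le_natDegree ?_
    have : p.natDegree ≤ (PP N).card := by
      refine (Polynomial.natDegree_prod_le _ _).trans ?_
      refine (Finset.sum_le_card_nsmul _ _ 1 fun q _ => ?_).trans (by simp)
      rw [add_comm]
      exact Polynomial.natDegree_linear_le
    exact_mod_cast Nat.lt_succ_of_le this
  have hinterp := Lagrange.eq_interpolate (s := Finset.range ((PP N).card + 1))
    (v := fun j : ℕ => (j : ℝ)) (f := p) (fun a _ b _ h => by simpa using h) hdeg
  have h1 : p.derivative.eval 0 = dD d x := by
    have e1 := p.hasDerivAt 0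
    have e2 := hasDerivAt_Dl x d 0
    have e3 : (fun t => p.eval t) = fun t => Dl (fun i => x i + t * d i) := funext hpe
    rw [e3] at e1
    have := e1.unique e2
    simpa using this
  rw [← h1]
  conv_lhs => rw [hinterp]
  rw [Lagrange.interpolate_apply, Polynomial.derivative_sum, Polynomial.eval_finsetSum]
  refine Finset.sum_congr rfl fun j _ => ?_
  rw [Polynomial.derivative_C_mul, Polynomial.eval_C_mul, hpe]
  ring

lemma Dl_bound (w : Fin N → ℝ) : |Dl w| ≤ Real.exp (2 * (PP N).card * ∑ i, |w i|) := by
  rw [Dl, Finset.abs_prod]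
  have h : ∀ p ∈ PP N, |w p.1 - w p.2| ≤ Real.exp (2 * ∑ i, |w i|) := by
    intro p _
    have h1 := Finset.single_le_sum (f := fun i => |w i|) (fun i _ => abs_nonneg _)
      (Finset.mem_univ p.1)
    have h2 := Finset.single_le_sum (f := fun i => |w i|) (fun i _ => abs_nonneg _)
      (Finset.mem_univ p.2)
    have h3 := abs_sub (w p.1) (w p.2)
    have h4 := Real.add_one_le_exp (2 * ∑ i, |w i|)
    linarith
  refine (Finset.prod_le_prod (fun p _ => abs_nonneg _) h).trans ?_
  rw [Finset.prod_const, ← Real.exp_nat_mul]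
  refine le_of_eq ?_
  congr 1; ring

end gauss

section fubini

open ProbabilityTheory
open scoped NNReal

variable {N : ℕ} [MeasurableSpace (UG N)] [BorelSpace (UG N)]
    (ν : Measure (UG N)) [ν.IsHaarMeasure] [IsProbabilityMeasure ν]

lemma fub_int (v : ℝ≥0) (x y : Fin N → ℝ) (A : UG N → ℝ) (hA : Continuous A) (j : ℝ) :
    Integrable (fun p : UG N × (Fin N → ℝ) =>
      Real.exp (dot (fun i => x i + p.2 i) (dg y p.1)) *
        (A p.1 * Dl (fun i => (x i + p.2 i) + j * dg y p.1 i))) (ν.prod (gam N v)) := by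
  obtain ⟨CA, hCA⟩ := (isCompact_range hA).isBounded.exists_norm_le
  obtain ⟨K, hK⟩ := (isCompact_range (continuous_dgv y (continuous_id (X := UG N)))).isBounded.exists_norm_le
  have hCA' : ∀ U, |A U| ≤ CA := fun U => hCA _ ⟨U, rfl⟩
  have hK' : ∀ U i, |dg y U i| ≤ K := fun U i =>
    (norm_le_pi_norm (dg y U) i).trans (hK _ ⟨U, rfl⟩)
  set n : ℝ := ((PP N).card : ℝ) with hn
  have hn0 : 0 ≤ n := by positivity
  have hbi : Integrable (fun u : Fin N → ℝ => ∏ i, Real.exp ((K + 2 * n) * |u i|)) (gam N v) := by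
    refine Integrable.fintype_prod (f := fun _ (u : ℝ) => Real.exp ((K + 2 * n) * |u|)) fun i => ?_
    exact integrable_exp_mul_abs (X := fun u : ℝ => u) (integrable_exp_mul_gaussianReal _)
      (integrable_exp_mul_gaussianReal _)
  have hbi2 := ((hbi.const_mul (CA * Real.exp (∑ i, (K * |x i| + 2 * n * (|x i| + |j| * K))))).comp_snd ν)
  refine hbi2.mono' ?_ ?_
  · apply Continuous.aestronglyMeasurable
    fun_prop
  · refine Eventually.of_forall fun p => ?_
    obtain ⟨U, u⟩ := p
    simp only [Real.norm_eq_abs, abs_mul, Real.abs_exp]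
    have h1 : dot (fun i => x i + u i) (dg y U) ≤ ∑ i, K * (|x i| + |u i|) := by
      refine Finset.sum_le_sum fun i _ => ?_
      calc (x i + u i) * dg y U i ≤ |(x i + u i) * dg y U i| := le_abs_self _
        _ = |dg y U i| * |x i + u i| := by rw [abs_mul, mul_comm]
        _ ≤ K * (|x i| + |u i|) := by
          have := hK' U i
          have := abs_add_le (x i) (u i)
          gcongr
          exact (abs_nonneg _).trans (hK' U i)
    have h2 : |Dl (fun i => (x i + u i) + j * dg y U i)| ≤
        Real.exp (∑ i, 2 * n * (|x i| + |u i| + |j| * K)) := by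
      refine (Dl_bound _).trans ?_
      rw [Finset.mul_sum]
      refine Real.exp_le_exp.mpr (Finset.sum_le_sum fun i _ => ?_)
      have e1 := abs_add_three (x i) (u i) (j * dg y U i)
      have e2 : |j * dg y U i| ≤ |j| * K := by
        rw [abs_mul]; exact mul_le_mul_of_nonneg_left (hK' U i) (abs_nonneg _)
      refine mul_le_mul_of_nonneg_left (by linarith) (by positivity)
    have h3 : CA * Real.exp (∑ i, (K * |x i| + 2 * n * (|x i| + |j| * K))) *
        ∏ i, Real.exp ((K + 2 * n) * |u i|) =
        Real.exp (∑ i, K * (|x i| + |u i|)) *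
          (CA * Real.exp (∑ i, 2 * n * (|x i| + |u i| + |j| * K))) := by
      rw [← Real.exp_sum, mul_assoc, ← Real.exp_add, mul_left_comm, ← Real.exp_add,
        ← Finset.sum_add_distrib, ← Finset.sum_add_distrib]
      congr 2
      refine Finset.sum_congr rfl fun i _ => by ring
    rw [h3]
    have := hCA' U
    gcongr
    exact (abs_nonneg _).trans (hCA' U)

lemma gam_Dl' {v : ℝ≥0} (hv : v ≠ 0) (x d : Fin N → ℝ) (j A : ℝ) :
    ∫ u, Real.exp (dot (fun i => x i + u i) d) * (A * Dl (fun i => (x i + u i) + j * d i)) ∂(gam N v)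
      = Real.exp (dot x d + v * dot d d / 2) * (A * Dl (fun i => (x i + v * d i) + j * d i)) := by
  have h := gam_Dl hv (fun i => x i + j * d i) d
  have h1 : ∀ u : Fin N → ℝ, Real.exp (dot (fun i => x i + u i) d) *
      (A * Dl (fun i => (x i + u i) + j * d i)) = (Real.exp (dot x d) * A) *
      (Real.exp (dot u d) * Dl (fun i => (x i + j * d i) + u i)) := by
    intro u
    have e1 : dot (fun i => x i + u i) d = dot x d + dot u d := by
      simp only [dot, add_mul, Finset.sum_add_distrib]
    have e2 : (fun i => (x i + u i) + j * d i) = fun i => (x i + j * d i) + u i := by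
      ext i; ring
    rw [e1, e2, Real.exp_add]; ring
  simp_rw [h1]
  rw [integral_const_mul, h, Real.exp_add]
  have e2 : (fun i => (x i + v * d i) + j * d i) = fun i => (x i + j * d i) + v * d i := by
    ext i; ring
  rw [e2]; ring

lemma P5 (v : ℝ≥0) (x y : Fin N → ℝ) :
    ∫ U, Real.exp (dot x (dg y U) + v * dot (dg y U) (dg y U) / 2) *
      ((1/2) * (dot (dg y U) (dg y U) - dot y y) * Dl (fun i => x i + v * dg y U i)
      + dD (dg y U) (fun i => x i + v * dg y U i)) ∂ν = 0 := by
  by_cases hv : v = 0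
  · subst hv
    simpa using P3 ν x y
  obtain ⟨c, hc⟩ := dD_comb N
  set b : ℕ → UG N → ℝ := fun j U =>
    c j + if j = 0 then (1/2) * (dot (dg y U) (dg y U) - dot y y) else 0 with hb
  have hbc : ∀ j, Continuous (b j) := by
    intro j
    by_cases h : j = 0
    · simp only [hb, h, if_true]; fun_prop
    · simp only [hb, h, if_false]; fun_prop
  have key : ∀ (z : Fin N → ℝ) (U : UG N), (1/2) * (dot (dg y U) (dg y U) - dot y y) * Dl z
      + dD (dg y U) z = ∑ j ∈ Finset.range ((PP N).card + 1),
        b j U * Dl (fun i => z i + j * dg y U i) := by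
    intro z U
    rw [hc]
    simp only [hb, add_mul, Finset.sum_add_distrib, ite_mul, zero_mul]
    rw [add_comm]
    congr 1
    rw [Finset.sum_ite_eq' ]
    simp
  have hcont : ∀ j : ℕ, Continuous fun U : UG N =>
      Real.exp (dot x (dg y U) + v * dot (dg y U) (dg y U) / 2) *
        (b j U * Dl (fun i => (x i + v * dg y U i) + j * dg y U i)) := by
    intro j
    have := hbc j
    fun_prop
  simp_rw [key, Finset.mul_sum]
  rw [integral_finsetSum _ (fun j _ => integrable_cont ν (hcont j))]
  have h1 : ∀ j : ℕ, ∫ U, Real.exp (dot x (dg y U) + v * dot (dg y U) (dg y U) / 2) *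
        (b j U * Dl (fun i => (x i + v * dg y U i) + j * dg y U i)) ∂ν =
      ∫ u, (∫ U, Real.exp (dot (fun i => x i + u i) (dg y U)) *
        (b j U * Dl (fun i => (x i + u i) + j * dg y U i)) ∂ν) ∂(gam N v) := by
    intro j
    simp_rw [← gam_Dl' hv]
    exact integral_integral_swap (fub_int ν v x y (b j) (hbc j) j)
  simp_rw [h1]
  rw [← integral_finsetSum _ (fun j _ => (fub_int ν v x y (b j) (hbc j) j).integral_prod_right)]
  rw [← integral_zero (Fin N → ℝ) ℝ (μ := gam N v)]
  refine integral_congr_ae (Eventually.of_forall fun u => ?_)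
  simp only
  rw [← integral_finsetSum]
  · simp_rw [← Finset.mul_sum, ← key]
    exact P3 ν (fun i => x i + u i) y
  · intro j _
    have := hbc j
    exact integrable_cont ν (by fun_prop)

noncomputable def II (x y : Fin N → ℝ) : ℝ := ∫ U, Real.exp (dot x (dg y U)) ∂ν

lemma P6 {s : ℝ} (hs : 0 ≤ s) (x y : Fin N → ℝ) :
    ∫ U, Real.exp (dot x (dg y U) - s * (1 / 2 * (dot y y - dot (dg y U) (dg y U)))) *
      Dl (fun i => x i + s * dg y U i) ∂ν = Dl x * II ν x y := by
  set F : ℝ → UG N → ℝ := fun s U =>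
    Real.exp (dot x (dg y U) - s * (1 / 2 * (dot y y - dot (dg y U) (dg y U)))) *
      Dl (fun i => x i + s * dg y U i) with hF
  set F' : ℝ → UG N → ℝ := fun s U =>
    Real.exp (dot x (dg y U) - s * (1 / 2 * (dot y y - dot (dg y U) (dg y U)))) *
    ((1/2) * (dot (dg y U) (dg y U) - dot y y) * Dl (fun i => x i + s * dg y U i)
      + dD (dg y U) (fun i => x i + s * dg y U i)) with hF'
  have hd : ∀ t, HasDerivAt (fun t => ∫ U, F t U ∂ν) (∫ U, F' t U ∂ν) t := by
    intro t
    refine hasDerivAt_int ν F F' ?_ ?_ ?_ t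
    · simp only [hF, Function.uncurry_def]; fun_prop
    · simp only [hF', Function.uncurry_def]; fun_prop
    · intro t U
      have h1 := (((hasDerivAt_id t).mul_const
        (1 / 2 * (dot y y - dot (dg y U) (dg y U)))).const_sub (dot x (dg y U))).exp
      refine (h1.mul (hasDerivAt_Dl x (dg y U) t)).congr_deriv ?_
      simp only [hF', id]
      ring
  have hz : ∀ t, 0 ≤ t → ∫ U, F' t U ∂ν = 0 := by
    intro t ht
    have h := P5 ν ⟨t, ht⟩ x y
    have e : ∀ U, F' t U = Real.exp (-(t * dot y y / 2)) *
        (Real.exp (dot x (dg y U) + t * dot (dg y U) (dg y U) / 2) *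
      ((1/2) * (dot (dg y U) (dg y U) - dot y y) * Dl (fun i => x i + t * dg y U i)
      + dD (dg y U) (fun i => x i + t * dg y U i))) := by
      intro U
      rw [← mul_assoc, ← Real.exp_add]
      simp only [hF']
      congr 2
      ring
    simp_rw [e]
    rw [integral_const_mul]
    exact mul_eq_zero_of_right _ h
  have hcst := constant_of_has_deriv_right_zero (f := fun t => ∫ U, F t U ∂ν) (a := 0) (b := s)
    (fun t _ => (hd t).continuousAt.continuousWithinAt)
    (fun t ht => by
      have := (hd t).hasDerivWithinAt (s := Set.Ici t)
      rwa [hz t ht.1] at this) s ⟨hs, le_rfl⟩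
  rw [hcst]
  simp only [hF, zero_mul, sub_zero, add_zero]
  rw [integral_mul_const, II, mul_comm]

end fubini

section final

variable {N : ℕ}

noncomputable def DD (x y : Fin N → ℝ) : ℝ :=
  (Matrix.of fun i j => Real.exp (x i * y j)).det

lemma DD_symm (x y : Fin N → ℝ) : DD x y = DD y x := by
  unfold DD
  rw [← Matrix.det_transpose]
  congr 1
  ext i j
  simp [mul_comm]

lemma DD_perm (x y : Fin N → ℝ) (σ : Equiv.Perm (Fin N)) :
    DD x (y ∘ σ) = (Equiv.Perm.sign σ : ℤ) * DD x y := by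
  unfold DD
  rw [← Matrix.det_permute']
  rfl

lemma DD_x0_ne {y : Fin N → ℝ} (hy : Function.Injective y) :
    DD (fun i : Fin N => ((i : ℕ) : ℝ)) y ≠ 0 := by
  have : (Matrix.of fun i j : Fin N => Real.exp (((i : ℕ) : ℝ) * y j)) =
      (Matrix.vandermonde (fun j => Real.exp (y j))).transpose := by
    ext i j
    simp [Matrix.vandermonde_apply, ← Real.exp_nat_mul]
  rw [DD, this, Matrix.det_transpose, Matrix.det_vandermonde_ne_zero_iff]
  exact fun a b h => hy (Real.exp_injective h)

lemma row_ne (U : UG N) (i : Fin N) : ∃ j, U.1 i j ≠ 0 := by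
  by_contra hcon
  push Not at hcon
  have h := congrFun (congrFun (Matrix.mem_unitaryGroup_iff.mp U.2) i) i
  rw [Matrix.mul_apply] at h
  simp [hcon] at h

lemma col_ne (U : UG N) (j : Fin N) : ∃ i, U.1 i j ≠ 0 := by
  by_contra hcon
  push Not at hcon
  have h := congrFun (congrFun (Matrix.mem_unitaryGroup_iff'.mp U.2) j) j
  rw [Matrix.mul_apply] at h
  simp [hcon] at h

lemma hnonneg (y : Fin N → ℝ) (U : UG N) :
    0 ≤ 1 / 2 * (dot y y - dot (dg y U) (dg y U)) := by
  rw [sum_sq y U]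
  have : 0 ≤ ∑ p ∈ PP N, (rho y U p.1 p.2 ^ 2 + sig y U p.1 p.2 ^ 2) :=
    Finset.sum_nonneg fun p _ => by positivity
  linarith

lemma dg_perm_of_zero {y : Fin N → ℝ} (hy : Function.Injective y) (U : UG N)
    (h : 1 / 2 * (dot y y - dot (dg y U) (dg y U)) = 0) :
    ∃ τ : Equiv.Perm (Fin N), dg y U = y ∘ τ := by
  rw [sum_sq y U] at h
  have h0 : ∑ p ∈ PP N, (rho y U p.1 p.2 ^ 2 + sig y U p.1 p.2 ^ 2) = 0 := by linarith
  rw [Finset.sum_eq_zero_iff_of_nonneg (fun p _ => by positivity)] at h0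
  have h1 : ∀ i k, k < i → rho y U i k = 0 ∧ sig y U i k = 0 := by
    intro i k hik
    have := h0 (i, k) (by simp [PP, hik])
    simp only at this
    constructor <;> nlinarith [sq_nonneg (rho y U i k), sq_nonneg (sig y U i k)]
  have h2 : ∀ i k, i ≠ k → rho y U i k = 0 ∧ sig y U i k = 0 := by
    intro i k hik
    rcases lt_or_gt_of_ne hik with hlt | hlt
    · have := h1 k i hlt
      rw [rho_symm, sig_symm, this.1, this.2]; simp
    · exact h1 i k hlt
  have hB : (U.1 : Matrix (Fin N) (Fin N) ℂ) * Matrix.diagonal (fun i => (y i : ℂ)) *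
      star (U.1 : Matrix (Fin N) (Fin N) ℂ) = Matrix.diagonal (fun i => (dg y U i : ℂ)) := by
    ext i k
    rw [Bmat]
    by_cases hik : i = k
    · subst hik
      rw [rho_self, sig_self, Matrix.diagonal_apply_eq]; rfl
    · rw [(h2 i k hik).1, (h2 i k hik).2, Matrix.diagonal_apply_ne _ hik]; rfl
  have hB2 : (U.1 : Matrix (Fin N) (Fin N) ℂ) * Matrix.diagonal (fun i => (y i : ℂ)) =
      Matrix.diagonal (fun i => (dg y U i : ℂ)) * (U.1 : Matrix (Fin N) (Fin N) ℂ) := by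
    rw [← hB, mul_assoc _ (star _), Matrix.mem_unitaryGroup_iff'.mp U.2, mul_one]
  have hB3 : ∀ i j, U.1 i j ≠ 0 → y j = dg y U i := by
    intro i j hij
    have := congrFun (congrFun hB2 i) j
    rw [Matrix.mul_diagonal, Matrix.diagonal_mul, mul_comm] at this
    exact_mod_cast mul_right_cancel₀ hij this
  choose τ hτ using row_ne U
  have hsurj : Function.Surjective τ := by
    intro j
    obtain ⟨i, hi⟩ := col_ne U j
    refine ⟨i, hy ?_⟩
    rw [hB3 i j hi, hB3 i _ (hτ i)]
  refine ⟨Equiv.ofBijective τ (Finite.surjective_iff_bijective.mp hsurj), ?_⟩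
  ext i
  exact (hB3 i _ (hτ i)).symm

noncomputable def permM (σ : Equiv.Perm (Fin N)) : Matrix (Fin N) (Fin N) ℂ :=
  Matrix.of fun a b => if b = σ a then 1 else 0

noncomputable def permU (σ : Equiv.Perm (Fin N)) : UG N :=
  ⟨permM σ, by
    rw [Matrix.mem_unitaryGroup_iff]
    ext a b
    rw [Matrix.mul_apply]
    simp [permM, Matrix.star_apply, Matrix.one_apply, eq_comm]⟩

lemma dg_permU (σ : Equiv.Perm (Fin N)) (y : Fin N → ℝ) (U : UG N) (a : Fin N) :
    dg y (permU σ * U) a = dg y U (σ a) := by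
  have h : ∀ j, (permU σ * U).1 a j = U.1 (σ a) j := by
    intro j
    change (permM σ * (U.1 : Matrix (Fin N) (Fin N) ℂ)) a j = _
    rw [Matrix.mul_apply]
    simp [permM]
  simp only [dg, h]

lemma dg_one (y : Fin N → ℝ) : dg y (1 : UG N) = y := by
  ext i
  unfold dg
  have : ∀ j, ((1 : UG N).1 i j) = if i = j then 1 else 0 := fun j => Matrix.one_apply
  simp [this, apply_ite Complex.normSq]

variable [MeasurableSpace (UG N)] [BorelSpace (UG N)]
    (ν : Measure (UG N)) [ν.IsHaarMeasure] [IsProbabilityMeasure ν]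

lemma II_perm (x y : Fin N → ℝ) (σ : Equiv.Perm (Fin N)) : II ν (x ∘ σ) y = II ν x y := by
  unfold II
  rw [← integral_mul_left_eq_self (fun U => Real.exp (dot (x ∘ σ) (dg y U))) (permU σ)]
  refine integral_congr_ae (Eventually.of_forall fun U => ?_)
  simp only [dot, dg_permU]
  congr 1
  exact Equiv.sum_comp σ (fun a => x a * dg y U a)

lemma II_symm (x y : Fin N → ℝ) : II ν x y = II ν y x := by
  unfold II
  rw [← integral_inv_UG ν _ (by fun_prop)]
  refine integral_congr_ae (Eventually.of_forall fun U => ?_)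
  have h : ∀ i j, (U⁻¹).1 i j = star (U.1 j i) := fun i j => rfl
  simp only [dot, dg, h, Finset.mul_sum]
  rw [Finset.sum_comm]
  congr 1
  refine Finset.sum_congr rfl fun i _ => Finset.sum_congr rfl fun j _ => ?_
  simp
  ring

lemma II_pos (x y : Fin N → ℝ) : 0 < II ν x y :=
  integral_exp_pos (integrable_cont ν (by fun_prop))

noncomputable def ZZ (y : Fin N → ℝ) (s : ℝ) : ℝ :=
  ∫ U, Real.exp (-(s * (1 / 2 * (dot y y - dot (dg y U) (dg y U))))) ∂ν

lemma P7 {s : ℝ} (hs : 0 < s) (x y : Fin N → ℝ) :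
    ∫ U, Real.exp (-(s * (1 / 2 * (dot y y - dot (dg y U) (dg y U))))) *
      (Real.exp (dot x (dg y U)) * Dl (fun i => dg y U i + s⁻¹ * x i)) ∂ν =
    (s ^ (PP N).card)⁻¹ * (Dl x * II ν x y) := by
  rw [← P6 ν hs.le x y, ← integral_const_mul]
  refine integral_congr_ae (Eventually.of_forall fun U => ?_)
  have h1 : Dl (fun i => x i + s * dg y U i) =
      s ^ (PP N).card * Dl (fun i => dg y U i + s⁻¹ * x i) := by
    rw [← Dl_smul]
    congr 1
    ext i
    field_simp
    ring
  simp only [h1]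
  rw [sub_eq_add_neg (dot x (dg y U)), Real.exp_add]
  have : s ^ (PP N).card ≠ 0 := by positivity
  field_simp

lemma P8 {y : Fin N → ℝ} (hy : Function.Injective y) (x : Fin N → ℝ) :
    Tendsto (fun s : ℝ => ((Nat.factorial N : ℝ) * (s ^ (PP N).card)⁻¹ / ZZ ν y s) *
      (Dl x * II ν x y)) atTop (𝓝 (Dl y * DD x y)) := by
  set g : ℝ → UG N → ℝ := fun ε U => ∑ σ : Equiv.Perm (Fin N), ((Equiv.Perm.sign σ : ℤ) : ℝ) *
    (Real.exp (dot (x ∘ σ) (dg y U)) * Dl (fun i => dg y U i + ε * (x ∘ σ) i)) with hg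
  have hgc : Continuous (Function.uncurry g) := by
    simp only [hg, Function.uncurry_def]; fun_prop
  have hL := laplace ν (fun U => 1 / 2 * (dot y y - dot (dg y U) (dg y U))) (by fun_prop)
    (hnonneg y) 1 (by rw [dg_one]; ring) g hgc (Dl y * DD x y) (by
      intro U hU
      obtain ⟨τ, hτ⟩ := dg_perm_of_zero hy U hU
      simp only [hg, zero_mul, add_zero]
      have e : ∑ σ : Equiv.Perm (Fin N), ((Equiv.Perm.sign σ : ℤ) : ℝ) *
          (Real.exp (dot (x ∘ σ) (dg y U)) * Dl (fun i => dg y U i)) =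
          Dl (dg y U) * DD x (dg y U) := by
        rw [DD, Matrix.det_apply', Finset.mul_sum]
        refine Finset.sum_congr rfl fun σ _ => ?_
        simp only [dot, Real.exp_sum, Matrix.of_apply, Function.comp]
        ring
      rw [e, hτ, Dl_perm, DD_perm]
      have hs : ((Equiv.Perm.sign τ : ℤ) : ℝ) * ((Equiv.Perm.sign τ : ℤ) : ℝ) = 1 := by
        rcases Int.units_eq_one_or (Equiv.Perm.sign τ) with h | h <;> simp [h]
      linear_combination (Dl y * DD x y) * hs)
  refine hL.congr' ?_
  filter_upwards [eventually_gt_atTop 0] with s hs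
  have hnum : ∫ U, Real.exp (-(s * (1 / 2 * (dot y y - dot (dg y U) (dg y U))))) * g s⁻¹ U ∂ν =
      (Nat.factorial N : ℝ) * ((s ^ (PP N).card)⁻¹ * (Dl x * II ν x y)) := by
    simp only [hg, Finset.mul_sum]
    rw [integral_finsetSum _ (fun σ _ => integrable_cont ν (by fun_prop))]
    have : ∀ σ : Equiv.Perm (Fin N),
        ∫ U, Real.exp (-(s * (1 / 2 * (dot y y - dot (dg y U) (dg y U))))) *
        (((Equiv.Perm.sign σ : ℤ) : ℝ) * (Real.exp (dot (x ∘ σ) (dg y U)) *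
          Dl (fun i => dg y U i + s⁻¹ * (x ∘ σ) i))) ∂ν =
        (s ^ (PP N).card)⁻¹ * (Dl x * II ν x y) := by
      intro σ
      simp_rw [mul_left_comm (Real.exp (-_)) ((Equiv.Perm.sign σ : ℤ) : ℝ)]
      rw [integral_const_mul, P7 ν hs, II_perm, Dl_perm]
      have hs : ((Equiv.Perm.sign σ : ℤ) : ℝ) * ((Equiv.Perm.sign σ : ℤ) : ℝ) = 1 := by
        rcases Int.units_eq_one_or (Equiv.Perm.sign σ) with h | h <;> simp [h]
      linear_combination ((s ^ (PP N).card)⁻¹ * (Dl x * II ν x y)) * hs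
    simp_rw [this]
    rw [Finset.sum_const, Finset.card_univ, Fintype.card_perm, Fintype.card_fin, nsmul_eq_mul]
  rw [hnum, ZZ]
  ring

lemma P9 {y : Fin N → ℝ} (hy : Function.Injective y) :
    ∃ c : ℝ, c ≠ 0 ∧ ∀ x, Dl x * Dl y * II ν x y = c * DD x y := by
  set x0 : Fin N → ℝ := fun i => ((i : ℕ) : ℝ) with hx0
  have hx0i : Function.Injective x0 := by
    intro a b h
    simp only [hx0] at h
    exact Fin.ext (by exact_mod_cast h)
  have hq : Dl x0 * II ν x0 y ≠ 0 := mul_ne_zero (Dl_ne_zero hx0i) (II_pos ν x0 y).ne'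
  have hyD := Dl_ne_zero hy
  have hl : Dl y * DD x0 y / (Dl x0 * II ν x0 y) ≠ 0 :=
    div_ne_zero (mul_ne_zero hyD (DD_x0_ne hy)) hq
  set l := Dl y * DD x0 y / (Dl x0 * II ν x0 y) with hldef
  have hA : Tendsto (fun s : ℝ => (Nat.factorial N : ℝ) * (s ^ (PP N).card)⁻¹ / ZZ ν y s) atTop
      (𝓝 l) := by
    have := (P8 ν hy x0).div_const (Dl x0 * II ν x0 y)
    refine this.congr fun s => ?_
    exact mul_div_cancel_right₀ _ hq
  have hx : ∀ x, l * (Dl x * II ν x y) = Dl y * DD x y := fun x =>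
    tendsto_nhds_unique (hA.mul_const _) (P8 ν hy x)
  refine ⟨Dl y ^ 2 / l, div_ne_zero (pow_ne_zero _ hyD) hl, fun x => ?_⟩
  rw [div_mul_eq_mul_div, eq_div_iff hl]
  linear_combination Dl y * hx x

lemma main_real : ∃ κ : ℝ, κ ≠ 0 ∧ ∀ x y : Fin N → ℝ, Function.Injective x →
    Function.Injective y → II ν x y = κ * DD x y / (Dl x * Dl y) := by
  have hx0i : Function.Injective (fun i : Fin N => ((i : ℕ) : ℝ)) := by
    intro a b h
    simp only at h
    exact Fin.ext (by exact_mod_cast h)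
  obtain ⟨κ, hκ, h0⟩ := P9 ν hx0i
  refine ⟨κ, hκ, fun x y hx hy => ?_⟩
  have hD := mul_ne_zero (Dl_ne_zero hx) (Dl_ne_zero hy)
  rw [eq_div_iff hD]
  obtain ⟨c, hc, h1⟩ := P9 ν hy
  have e1 := h0 y
  have e2 := h1 (fun i : Fin N => ((i : ℕ) : ℝ))
  rw [II_symm, DD_symm] at e1
  have e3 : c = κ := by
    refine mul_right_cancel₀ (DD_x0_ne hy) ?_
    rw [← e1, ← e2]; ring
  have := h1 x
  rw [e3] at this
  linarith

end final
end HCIZ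

end helpers

open MeasureTheory
open scoped BigOperators

/-- Harish-Chandra / Itzykson–Zuber formula, Lemma 2.6 of the paper.
For real diagonal `X = diag(x)`, `Y = diag(y)` with pairwise distinct entries,
`∫_{U(N)} exp(tr(X U Y U*)) dν(U) = κ_N · det(e^{xᵢyⱼ}) / (Δ(x)Δ(y))` for a nonzero
constant `κ_N` depending only on `N`. -/
theorem statement4 (N : ℕ) (hN : 1 ≤ N)
    [MeasurableSpace (Matrix.unitaryGroup (Fin N) ℂ)]
    [BorelSpace (Matrix.unitaryGroup (Fin N) ℂ)]
    (ν : Measure (Matrix.unitaryGroup (Fin N) ℂ)) [ν.IsHaarMeasure]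
    [IsProbabilityMeasure ν] :
    ∃ κ : ℝ, κ ≠ 0 ∧
      ∀ x y : Fin N → ℝ, Function.Injective x → Function.Injective y →
        (∫ U : Matrix.unitaryGroup (Fin N) ℂ,
            Complex.exp
              (Matrix.trace
                (Matrix.diagonal (fun i => (x i : ℂ)) * (U : Matrix (Fin N) (Fin N) ℂ) *
                  Matrix.diagonal (fun i => (y i : ℂ)) *
                  star (U : Matrix (Fin N) (Fin N) ℂ))) ∂ν)
          = (κ : ℂ) *
              Matrix.det (Matrix.of fun i j => Complex.exp ((x i : ℂ) * (y j : ℂ))) /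
              (((∏ i : Fin N, ∏ j ∈ Finset.Iio i, (x i - x j)) *
                (∏ i : Fin N, ∏ j ∈ Finset.Iio i, (y i - y j)) : ℝ) : ℂ) := by
  obtain ⟨κ, hκ, h⟩ := HCIZ.main_real ν
  refine ⟨κ, hκ, fun x y hx hy => ?_⟩
  have h1 : ∀ U : Matrix.unitaryGroup (Fin N) ℂ, Complex.exp
              (Matrix.trace
                (Matrix.diagonal (fun i => (x i : ℂ)) * (U : Matrix (Fin N) (Fin N) ℂ) *
                  Matrix.diagonal (fun i => (y i : ℂ)) *
                  star (U : Matrix (Fin N) (Fin N) ℂ))) =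
      ((Real.exp (HCIZ.dot x (HCIZ.dg y U)) : ℝ) : ℂ) := by
    intro U
    rw [Complex.ofReal_exp]
    congr 1
    rw [mul_assoc, mul_assoc, ← mul_assoc (U : Matrix (Fin N) (Fin N) ℂ), Matrix.trace, HCIZ.dot]
    push_cast
    refine Finset.sum_congr rfl fun i _ => ?_
    rw [Matrix.diag_apply, Matrix.diagonal_mul, HCIZ.Bmat, HCIZ.rho_self, HCIZ.sig_self]
    rfl
  simp_rw [h1]
  have h2 := h x y hx hy
  rw [HCIZ.II] at h2
  rw [integral_complex_ofReal, h2, HCIZ.Dl_eq, HCIZ.Dl_eq, Complex.ofReal_div, Complex.ofReal_mul]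
  congr 2
  rw [HCIZ.DD]
  have h3 := RingHom.map_det Complex.ofRealHom (Matrix.of fun i j => Real.exp (x i * y j))
  rw [Complex.ofRealHom_eq_coe] at h3
  rw [h3]
  congr 1
  ext i j
  simp
end

section
/- For every integer k ≥ 0 there exist constants C > 0 and M > 0 such that for all real z ≥ M one has |ψ_k(z) − z^k| ≤ C z^{k−1}; in other words ψ_k(z) = z^k(1 + O(1/z)) as z → +∞. -/
open MeasureTheory

/-- The generalized Hänkel function
`ψ_k(z) = (p^{c+1}/Γ(-c)) ∫_1^∞ z^{-c} (uz)^k e^{-(u-1)z} (u^p-1)^{-(c+1)} du`. -/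
noncomputable def genHankel (c : ℝ) (p k : ℕ) (z : ℝ) : ℝ :=
  ((p : ℝ) ^ (c + 1) / Real.Gamma (-c)) *
    ∫ u in Set.Ioi (1 : ℝ),
      z ^ (-c) * (u * z) ^ k * Real.exp (-((u - 1) * z)) * (u ^ p - 1) ^ (-(c + 1))

lemma exp_sub_one_le_aux (x : ℝ) : Real.exp x - 1 ≤ x * Real.exp x := by
  have h := Real.add_one_le_exp (-x)
  have h2 : Real.exp (-x) * Real.exp x = 1 := by rw [← Real.exp_add]; simp
  nlinarith [Real.exp_pos x]

lemma one_add_pow_le_exp_aux (n : ℕ) {t : ℝ} (ht : 0 < t) : (1 + t) ^ n ≤ Real.exp (n * t) := by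
  rw [Real.exp_nat_mul]
  exact pow_le_pow_left₀ (by linarith) (by linarith [Real.add_one_le_exp t]) n

/-- Pointwise comparison of the normalized amplitude with `1`. -/
lemma amplitude_aux (a : ℝ) (ha₀ : 0 < a) (ha₁ : a < 1) (p : ℕ) (hp : 2 ≤ p) (k : ℕ)
    {t : ℝ} (ht : 0 < t) :
    |(1 + t) ^ k * (((1 + t) ^ p - 1) / (p * t)) ^ (-a) - 1|
      ≤ (k + p) * t * Real.exp (k * t) := by
  have hp0 : (0 : ℝ) < p := by positivity
  have hpt : 0 < (p : ℝ) * t := by positivity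
  set q := ((1 + t) ^ p - 1) / (p * t) with hq
  have hq1 : 1 ≤ q := by
    rw [hq, le_div_iff₀ hpt]
    have := one_add_mul_le_pow (a := t) (by linarith) p
    linarith
  have hq2 : q ≤ Real.exp (p * t) := by
    rw [hq, div_le_iff₀ hpt]
    have := one_add_pow_le_exp_aux p ht
    have := exp_sub_one_le_aux (p * t)
    linarith
  have hu : q ^ (-a) ≤ 1 := Real.rpow_le_one_of_one_le_of_nonpos hq1 (by linarith)
  have hl : 1 - p * t ≤ q ^ (-a) := by
    have h1 : (Real.exp (p * t)) ^ (-a) ≤ q ^ (-a) :=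
      Real.rpow_le_rpow_of_nonpos (by linarith) hq2 (by linarith)
    rw [← Real.exp_mul] at h1
    have h2 := Real.add_one_le_exp ((p * t) * (-a))
    nlinarith
  have hqn : 0 ≤ q ^ (-a) := Real.rpow_nonneg (by linarith) _
  have hk1 : 1 ≤ (1 + t) ^ k := one_le_pow₀ (by linarith)
  have hk2 := one_add_pow_le_exp_aux k ht
  have hk3 := exp_sub_one_le_aux (k * t)
  have he : 1 ≤ Real.exp (k * t) := Real.one_le_exp (by positivity)
  have hpe : 0 ≤ p * t * Real.exp (k * t) := by positivity
  have hke : 0 ≤ k * t * Real.exp (k * t) := by positivity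
  rw [abs_le]
  constructor
  · nlinarith
  · nlinarith

lemma integrable_aux {s r : ℝ} (hs : 0 < s) (hr : 0 < r) :
    IntegrableOn (fun t : ℝ => t ^ (s - 1) * Real.exp (-(r * t))) (Set.Ioi 0) := by
  have h := integrableOn_rpow_mul_exp_neg_mul_rpow (p := 1) (s := s - 1) (b := r)
    (by linarith) one_pos hr
  simpa using h

lemma shift_aux (f : ℝ → ℝ) :
    ∫ u in Set.Ioi (1 : ℝ), f u = ∫ t in Set.Ioi (0 : ℝ), f (1 + t) := by
  have h := (measurePreserving_add_left (volume : Measure ℝ) 1).setIntegral_preimage_emb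
    (MeasurableEquiv.addLeft (1 : ℝ)).measurableEmbedding f (Set.Ioi 1)
  rw [← h]
  simp

/-- part of Lemma 4.1 of the paper.  `ψ_k(z) = z^k (1 + O(1/z))`
as `z → +∞`. -/
theorem statement5 (c : ℝ) (hc₁ : -1 < c) (hc₂ : c < 0) (p : ℕ) (hp : 2 ≤ p) (k : ℕ) :
    ∃ C > 0, ∃ M > 0, ∀ z : ℝ, M ≤ z →
      |genHankel c p k z - z ^ k| ≤ C * z ^ ((k : ℝ) - 1) := by
  have hs : 0 < -c := by linarith
  have hp0 : (0 : ℝ) < p := by positivity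
  have hG : 0 < Real.Gamma (-c) := Real.Gamma_pos_of_pos hs
  have hG1 : 0 < Real.Gamma (-c + 1) := Real.Gamma_pos_of_pos (by linarith)
  refine ⟨(k + p) * (Real.Gamma (-c + 1) / Real.Gamma (-c)) * 2 ^ (-c + 1), by positivity,
    2 * k + 1, by positivity, fun z hz => ?_⟩
  have hz0 : 0 < z := by
    have : (0 : ℝ) ≤ k := by positivity
    linarith
  set D : ℝ := z ^ (-c) * z ^ k * (p : ℝ) ^ (-(c + 1)) with hD
  have hD0 : 0 < D := by positivity
  set F : ℝ → ℝ := fun t => z ^ (-c) * ((1 + t) * z) ^ k * Real.exp (-((1 + t - 1) * z)) *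
    ((1 + t) ^ p - 1) ^ (-(c + 1)) with hF
  set N : ℝ → ℝ := fun t => D * (t ^ (-c - 1) * Real.exp (-(z * t))) with hN
  set B : ℝ → ℝ := fun t => D * (k + p) * (t ^ (-c + 1 - 1) * Real.exp (-(z / 2 * t))) with hB
  have hNi : IntegrableOn N (Set.Ioi 0) := (integrable_aux hs hz0).const_mul D
  have hBi : IntegrableOn B (Set.Ioi 0) :=
    (integrable_aux (s := -c + 1) (r := z / 2) (by linarith) (by linarith)).const_mul _
  have hNint : ∫ t in Set.Ioi 0, N t = D * ((1 / z) ^ (-c) * Real.Gamma (-c)) := by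
    rw [hN, integral_const_mul, Real.integral_rpow_mul_exp_neg_mul_Ioi hs hz0]
  have hBint : ∫ t in Set.Ioi 0, B t
      = D * (k + p) * ((1 / (z / 2)) ^ (-c + 1) * Real.Gamma (-c + 1)) := by
    rw [hB, integral_const_mul,
      Real.integral_rpow_mul_exp_neg_mul_Ioi (by linarith) (by linarith)]
  have hbound : ∀ t ∈ Set.Ioi (0 : ℝ), ‖F t - N t‖ ≤ B t := by
    intro t ht
    have ht : 0 < t := ht
    have hamp := amplitude_aux (c + 1) (by linarith) (by linarith) p hp k ht
    set q := ((1 + t) ^ p - 1) / (p * t) with hq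
    have hnum : 0 ≤ (1 + t) ^ p - 1 := by
      have : 1 ≤ (1 + t) ^ p := one_le_pow₀ (by linarith)
      linarith
    have hfac : (1 + t) ^ p - 1 = p * t * q := by
      rw [hq]; field_simp
    have hq0 : 0 ≤ q := by rw [hq]; positivity
    have hFe : F t - N t = N t * ((1 + t) ^ k * q ^ (-(c + 1)) - 1) := by
      simp only [hF, hN, hD]
      rw [hfac, Real.mul_rpow (by positivity) hq0, Real.mul_rpow hp0.le ht.le, mul_pow,
        show -((1 + t - 1) * z) = -(z * t) by ring, show -(c + 1) = -c - 1 by ring]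
      ring
    have hNt : 0 ≤ N t := by simp only [hN]; positivity
    rw [hFe, Real.norm_eq_abs, abs_mul, abs_of_nonneg hNt]
    refine (mul_le_mul_of_nonneg_left hamp hNt).trans ?_
    simp only [hN, hB]
    have e1 : t ^ (-c + 1 - 1) = t ^ (-c - 1) * t := by
      rw [← Real.rpow_add_one ht.ne']; congr 1; ring
    have e2 : Real.exp (-(z * t)) * Real.exp (k * t) ≤ Real.exp (-(z / 2 * t)) := by
      rw [← Real.exp_add, Real.exp_le_exp]
      nlinarith
    rw [e1]
    calc D * (t ^ (-c - 1) * Real.exp (-(z * t))) * ((k + p) * t * Real.exp (k * t))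
        = D * (k + p) * (t ^ (-c - 1) * t) * (Real.exp (-(z * t)) * Real.exp (k * t)) := by ring
      _ ≤ D * (k + p) * (t ^ (-c - 1) * t) * Real.exp (-(z / 2 * t)) :=
          mul_le_mul_of_nonneg_left e2 (by positivity)
      _ = _ := by ring
  have hae : ∀ᵐ t ∂(volume.restrict (Set.Ioi (0 : ℝ))), ‖F t - N t‖ ≤ B t :=
    (ae_restrict_mem measurableSet_Ioi).mono hbound
  have hmeas : Measurable (fun t => F t - N t) := by
    simp only [hF, hN]; fun_prop
  have hdi : IntegrableOn (fun t => F t - N t) (Set.Ioi 0) :=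
    Integrable.mono' hBi hmeas.aestronglyMeasurable hae
  have hFi : ∫ t in Set.Ioi 0, F t
      = (∫ t in Set.Ioi 0, (F t - N t)) + ∫ t in Set.Ioi 0, N t := by
    rw [← integral_add hdi hNi]; simp
  have hnorm : |∫ t in Set.Ioi 0, (F t - N t)| ≤ ∫ t in Set.Ioi 0, B t :=
    norm_integral_le_of_norm_le hBi hae
  have hpp : (p : ℝ) ^ (c + 1) * (p : ℝ) ^ (-(c + 1)) = 1 := by
    rw [← Real.rpow_add hp0]; simp
  have hzz : z ^ (-c) * (1 / z) ^ (-c) = 1 := by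
    rw [← Real.mul_rpow hz0.le (by positivity)]
    rw [mul_one_div_cancel hz0.ne', Real.one_rpow]
  set A : ℝ := (p : ℝ) ^ (c + 1) / Real.Gamma (-c) with hA
  have hA0 : 0 < A := by positivity
  have hAD : A * D = z ^ (-c) * z ^ k / Real.Gamma (-c) := by
    calc A * D = ((p : ℝ) ^ (c + 1) * (p : ℝ) ^ (-(c + 1))) *
          (z ^ (-c) * z ^ k / Real.Gamma (-c)) := by rw [hA, hD]; ring
      _ = _ := by rw [hpp, one_mul]
  have hmain : A * ∫ t in Set.Ioi 0, N t = z ^ k := by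
    rw [hNint, ← mul_assoc, hAD]
    calc _ = (z ^ (-c) * (1 / z) ^ (-c)) * z ^ k * (Real.Gamma (-c) / Real.Gamma (-c)) := by ring
      _ = _ := by rw [hzz, div_self hG.ne']; ring
  have hgen : genHankel c p k z - z ^ k = A * ∫ t in Set.Ioi 0, (F t - N t) := by
    have : genHankel c p k z = A * ∫ t in Set.Ioi 0, F t := by
      rw [genHankel, shift_aux]
    rw [this, hFi, mul_add, hmain]; ring
  rw [hgen, abs_mul, abs_of_pos hA0]
  refine (mul_le_mul_of_nonneg_left hnorm hA0.le).trans (le_of_eq ?_)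
  rw [hBint]
  have hz2 : (1 / (z / 2)) ^ (-c + 1) = 2 ^ (-c + 1) * ((1 / z) ^ (-c) * (1 / z)) := by
    rw [← Real.rpow_add_one (by positivity), ← Real.mul_rpow (by norm_num) (by positivity)]
    congr 1; field_simp
  have hzk : z ^ ((k : ℝ) - 1) = z ^ k * (1 / z) := by
    rw [Real.rpow_sub_one hz0.ne', Real.rpow_natCast]; ring
  rw [hz2, hzk]
  calc _ = A * D * (k + p) * (2 ^ (-c + 1) * ((1 / z) ^ (-c) * (1 / z)) * Real.Gamma (-c + 1)) := by
        ring
    _ = (z ^ (-c) * (1 / z) ^ (-c)) * ((k + p) * (Real.Gamma (-c + 1) / Real.Gamma (-c)) *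
          2 ^ (-c + 1) * (z ^ k * (1 / z))) := by rw [hAD]; ring
    _ = _ := by rw [hzz, one_mul]
end

section
/- Fix an integer k ≥ 0. Let b_{k,0} = 1, b_{k,1}, b_{k,2}, … be the Taylor coefficients at s = 0 of the function g(s) = (1+s)^k · (1 + (1/p) Σ_{j=2}^p binom(p,j) s^{j−1})^{−(c+1)} (using the principal branch of the power, which is analytic near s = 0), and set b̃_{k,i} = (∏_{m=0}^{i−1}(−c+m)) · b_{k,i} = (Γ(−c+i)/Γ(−c)) · b_{k,i}. Then for every integer n ≥ 0 there exist constants C > 0 and M > 0 such that for all real z ≥ M: | ψ_k(z) − z^k (1 + b̃_{k,1} z^{−1} + ⋯ + b̃_{k,n} z^{−n}) | ≤ C z^{k−n−1}. -/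
open MeasureTheory

/-- The function `g(s) = (1+s)^k (1 + (1/p) ∑_{j=2}^p binom(p,j) s^{j-1})^{-(c+1)}` whose
Taylor coefficients at `s = 0` are the `b_{k,i}`. -/
noncomputable def hankelExpandFn (c : ℝ) (p k : ℕ) (s : ℝ) : ℝ :=
  (1 + s) ^ k *
    (1 + (1 / (p : ℝ)) * ∑ j ∈ Finset.Icc 2 p, (p.choose j : ℝ) * s ^ (j - 1)) ^ (-(c + 1))

/-- The Taylor coefficient `b_{k,i}` of `hankelExpandFn` at `s = 0`. -/
noncomputable def hankelCoeff (c : ℝ) (p k i : ℕ) : ℝ :=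
  iteratedDeriv i (hankelExpandFn c p k) 0 / (Nat.factorial i : ℝ)

/-- The modified coefficient `b̃_{k,i} = (∏_{m=0}^{i-1} (-c+m)) · b_{k,i}`. -/
noncomputable def hankelCoeffTilde (c : ℝ) (p k i : ℕ) : ℝ :=
  (∏ m ∈ Finset.range i, (-c + (m : ℝ))) * hankelCoeff c p k i

lemma hk_inner_ge (p : ℕ) {s : ℝ} (hs : 0 ≤ s) :
    1 ≤ 1 + (1 / (p : ℝ)) * ∑ j ∈ Finset.Icc 2 p, (p.choose j : ℝ) * s ^ (j - 1) := by
  have : 0 ≤ (1 / (p : ℝ)) * ∑ j ∈ Finset.Icc 2 p, (p.choose j : ℝ) * s ^ (j - 1) := by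
    apply mul_nonneg (by positivity)
    exact Finset.sum_nonneg fun j _ => by positivity
  linarith

lemma hk_factor (p : ℕ) (hp : 2 ≤ p) (s : ℝ) :
    (s + 1) ^ p - 1 = (p : ℝ) * s *
      (1 + (1 / (p : ℝ)) * ∑ j ∈ Finset.Icc 2 p, (p.choose j : ℝ) * s ^ (j - 1)) := by
  have hp0 : (p : ℝ) ≠ 0 := by positivity
  have h1 : (s + 1) ^ p = ∑ j ∈ Finset.range (p + 1), (p.choose j : ℝ) * s ^ j := by
    rw [add_pow]
    refine Finset.sum_congr rfl fun j _ => ?_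
    simp [mul_comm]
  have h2 : Finset.range (p + 1) = insert 0 (insert 1 (Finset.Icc 2 p)) := by
    ext j
    simp only [Finset.mem_range, Finset.mem_insert, Finset.mem_Icc]
    omega
  rw [h1, h2, Finset.sum_insert (by simp), Finset.sum_insert (by simp)]
  have h3 : ∑ j ∈ Finset.Icc 2 p, (p.choose j : ℝ) * s ^ j
      = s * ∑ j ∈ Finset.Icc 2 p, (p.choose j : ℝ) * s ^ (j - 1) := by
    rw [Finset.mul_sum]
    refine Finset.sum_congr rfl fun j hj => ?_
    have : 2 ≤ j := (Finset.mem_Icc.mp hj).1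
    obtain ⟨m, rfl⟩ : ∃ m, j = m + 1 := ⟨j - 1, by omega⟩
    simp only [Nat.add_sub_cancel]
    ring
  rw [h3]
  simp only [Nat.choose_zero_right, Nat.choose_one_right, pow_zero, pow_one]
  field_simp
  push_cast
  ring

lemma hk_contDiffAt (c : ℝ) (p k : ℕ) {s : ℝ} (hs : 0 ≤ s) (N : ℕ) :
    ContDiffAt ℝ N (hankelExpandFn c p k) s := by
  have h := hk_inner_ge p hs
  unfold hankelExpandFn
  refine ContDiffAt.mul (by fun_prop) ?_
  refine ContDiffAt.rpow_const_of_ne ?_ (by linarith)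
  refine contDiffAt_const.add (contDiffAt_const.mul ?_)
  refine ContDiffAt.sum fun j _ => ?_
  fun_prop

lemma hk_remainder (c : ℝ) (hc₁ : -1 < c) (p k n : ℕ) :
    ∃ A : ℝ, 0 < A ∧ ∀ s : ℝ, 0 < s →
      |hankelExpandFn c p k s - ∑ i ∈ Finset.range (n + 1), hankelCoeff c p k i * s ^ i| ≤
        A * (s ^ (n + 1) + s ^ (n + 1 + k)) := by
  obtain ⟨C, hC⟩ := exists_taylor_mean_remainder_bound (f := hankelExpandFn c p k)
    (a := 0) (b := 1) (n := n) zero_le_one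
    (fun x hx => (by exact_mod_cast (hk_contDiffAt c p k hx.1 (n + 1)).contDiffWithinAt))
  have hT : ∀ s : ℝ, taylorWithinEval (hankelExpandFn c p k) n (Set.Icc 0 1) 0 s
      = ∑ i ∈ Finset.range (n + 1), hankelCoeff c p k i * s ^ i := by
    intro s
    rw [taylor_within_apply]
    refine Finset.sum_congr rfl fun i _ => ?_
    rw [iteratedDerivWithin_eq_iteratedDeriv (uniqueDiffOn_Icc zero_lt_one)
      (hk_contDiffAt c p k le_rfl i) (by simp)]
    simp only [hankelCoeff, sub_zero, smul_eq_mul]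
    field_simp
  set B := ∑ i ∈ Finset.range (n + 1), |hankelCoeff c p k i| with hB
  have hB0 : 0 ≤ B := Finset.sum_nonneg fun _ _ => abs_nonneg _
  refine ⟨|C| + 2 ^ k + B, by positivity, fun s hs => ?_⟩
  have hp1 : 0 ≤ s ^ (n + 1) := by positivity
  have hp2 : 0 ≤ s ^ (n + 1 + k) := by positivity
  have h2k : (0 : ℝ) ≤ 2 ^ k := by positivity
  rcases le_total s 1 with h1 | h1
  · have h := hC s ⟨hs.le, h1⟩
    rw [hT, Real.norm_eq_abs, sub_zero] at h
    refine h.trans ?_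
    have : C * s ^ (n + 1) ≤ |C| * s ^ (n + 1) :=
      mul_le_mul_of_nonneg_right (le_abs_self C) hp1
    have := abs_nonneg C
    nlinarith [mul_nonneg h2k hp1, mul_nonneg hB0 hp1, mul_nonneg this hp2,
      mul_nonneg h2k hp2, mul_nonneg hB0 hp2]
  · have hg0 : 0 ≤ hankelExpandFn c p k s := by
      unfold hankelExpandFn
      have := hk_inner_ge p hs.le
      exact mul_nonneg (by positivity) (Real.rpow_nonneg (by linarith) _)
    have hg : hankelExpandFn c p k s ≤ 2 ^ k * s ^ (n + 1 + k) := by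
      unfold hankelExpandFn
      have hq := Real.rpow_le_one_of_one_le_of_nonpos (hk_inner_ge p hs.le)
        (show -(c + 1) ≤ 0 by linarith)
      calc _ ≤ (1 + s) ^ k * 1 := mul_le_mul_of_nonneg_left hq (by positivity)
        _ ≤ (2 * s) ^ k := by
          rw [mul_one]; exact pow_le_pow_left₀ (by linarith) (by linarith) k
        _ = 2 ^ k * s ^ k := mul_pow _ _ _
        _ ≤ _ := mul_le_mul_of_nonneg_left (pow_le_pow_right₀ h1 (by omega)) h2k
    have hS : |∑ i ∈ Finset.range (n + 1), hankelCoeff c p k i * s ^ i| ≤ B * s ^ (n + 1) := by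
      refine (Finset.abs_sum_le_sum_abs _ _).trans ?_
      rw [hB, Finset.sum_mul]
      refine Finset.sum_le_sum fun i hi => ?_
      rw [abs_mul, abs_of_nonneg (pow_nonneg hs.le i)]
      exact mul_le_mul_of_nonneg_left
        (pow_le_pow_right₀ h1 (Finset.mem_range.mp hi).le) (abs_nonneg _)
    refine (abs_sub _ _).trans ?_
    rw [abs_of_nonneg hg0]
    have := abs_nonneg C
    nlinarith [mul_nonneg h2k hp1, mul_nonneg hB0 hp1, mul_nonneg this hp2,
      mul_nonneg this hp1, mul_nonneg hB0 hp2]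

lemma hk_eq (c : ℝ) (p : ℕ) (hp : 2 ≤ p) (k : ℕ) {z : ℝ} (hz : 0 < z) :
    genHankel c p k z = z ^ ((k : ℝ) - c) / Real.Gamma (-c) *
      ∫ s in Set.Ioi (0 : ℝ), s ^ (-c - 1) * Real.exp (-(z * s)) * hankelExpandFn c p k s := by
  unfold genHankel
  have hp0 : (0 : ℝ) < p := by positivity
  have hsub := (measurePreserving_add_right (volume : Measure ℝ) (1 : ℝ)).setIntegral_preimage_emb
    (MeasurableEquiv.addRight (1 : ℝ)).measurableEmbedding
    (fun u : ℝ => z ^ (-c) * (u * z) ^ k * Real.exp (-((u - 1) * z)) *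
      (u ^ p - 1) ^ (-(c + 1))) (Set.Ioi 1)
  rw [← hsub]
  have hpre : (fun x : ℝ => x + 1) ⁻¹' Set.Ioi 1 = Set.Ioi 0 := by
    ext x; simp
  rw [hpre, ← integral_const_mul, ← integral_const_mul]
  refine setIntegral_congr_fun measurableSet_Ioi fun s hs => ?_
  have hs : 0 < s := hs
  have hq := hk_inner_ge p hs.le
  simp only [hankelExpandFn]
  rw [hk_factor p hp s]
  set q := 1 + (1 / (p : ℝ)) * ∑ j ∈ Finset.Icc 2 p, (p.choose j : ℝ) * s ^ (j - 1)
  rw [Real.mul_rpow (by positivity) (by linarith), Real.mul_rpow hp0.le hs.le, mul_pow,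
    show s + 1 - 1 = s by ring, show -c - 1 = -(c + 1) by ring,
    show (k : ℝ) - c = k + (-c) by ring, Real.rpow_add hz, Real.rpow_natCast,
    Real.rpow_neg hp0.le, add_comm s 1, mul_comm s z]
  have : (p : ℝ) ^ (c + 1) ≠ 0 := (Real.rpow_pos_of_pos hp0 _).ne'
  field_simp

lemma hk_gamma (a : ℝ) (ha : 0 < a) (i : ℕ) :
    Real.Gamma (a + i) = (∏ m ∈ Finset.range i, (a + (m : ℝ))) * Real.Gamma a := by
  induction i with
  | zero => simp
  | succ i ih =>
    rw [Finset.prod_range_succ, Nat.cast_succ, ← add_assoc,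
      Real.Gamma_add_one (by positivity), ih]
    ring

lemma hk_integrable {a z : ℝ} (ha : 0 < a) (hz : 0 < z) :
    IntegrableOn (fun s : ℝ => s ^ (a - 1) * Real.exp (-(z * s))) (Set.Ioi 0) := by
  have := integrableOn_rpow_mul_exp_neg_mul_rpow (p := 1) (s := a - 1) (b := z)
    (by linarith) one_pos hz
  simpa using this

lemma hk_mul {c z s : ℝ} (hs : 0 < s) (i : ℕ) :
    s ^ (-c - 1) * Real.exp (-(z * s)) * s ^ i =
      s ^ ((-c + i) - 1) * Real.exp (-(z * s)) := by
  rw [show (-c + i) - 1 = (-c - 1) + (i : ℝ) by ring, Real.rpow_add hs, Real.rpow_natCast]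
  ring

lemma hk_val {c z : ℝ} (hc : c < 0) (hz : 0 < z) (k i : ℕ) :
    z ^ ((k : ℝ) - c) * ∫ s in Set.Ioi (0 : ℝ), s ^ ((-c + i) - 1) * Real.exp (-(z * s))
      = Real.Gamma (-c + i) * z ^ ((k : ℝ) - i) := by
  have ha : 0 < -c + (i : ℝ) := by have : (0 : ℝ) ≤ i := by positivity
                                   linarith
  rw [Real.integral_rpow_mul_exp_neg_mul_Ioi ha hz, one_div, Real.inv_rpow hz.le,
    ← Real.rpow_neg hz.le, ← mul_assoc, ← Real.rpow_add hz, mul_comm]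
  congr 2
  ring

/-- part of Lemma 4.1 of the paper.  Full asymptotic expansion
`ψ_k(z) = z^k (1 + b̃_{k,1} z⁻¹ + ⋯ + b̃_{k,n} z⁻ⁿ + O(z^{-n-1}))` as `z → +∞`. -/
theorem statement6 (c : ℝ) (hc₁ : -1 < c) (hc₂ : c < 0) (p : ℕ) (hp : 2 ≤ p)
    (k n : ℕ) :
    ∃ C > 0, ∃ M > 0, ∀ z : ℝ, M ≤ z →
      |genHankel c p k z -
          ∑ i ∈ Finset.range (n + 1), hankelCoeffTilde c p k i * z ^ ((k : ℝ) - i)| ≤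
        C * z ^ ((k : ℝ) - n - 1) := by
  obtain ⟨A, hA, hR⟩ := hk_remainder c hc₁ p k n
  have hpos : ∀ i : ℕ, 0 < -c + (i : ℝ) := fun i => by
    have : (0 : ℝ) ≤ i := by positivity
    linarith
  have hG := Real.Gamma_pos_of_pos (show 0 < -c by linarith)
  have hG1 := Real.Gamma_pos_of_pos (hpos (n + 1))
  have hG2 := Real.Gamma_pos_of_pos (hpos (n + 1 + k))
  refine ⟨A * (Real.Gamma (-c + (n + 1 : ℕ)) + Real.Gamma (-c + (n + 1 + k : ℕ))) /
    Real.Gamma (-c), by positivity, 1, one_pos, fun z hz1 => ?_⟩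
  have hz : 0 < z := by linarith
  rw [hk_eq c p hp k hz]
  set w : ℝ → ℝ := fun s => s ^ (-c - 1) * Real.exp (-(z * s)) with hw
  set R : ℝ → ℝ := fun s => hankelExpandFn c p k s -
    ∑ i ∈ Finset.range (n + 1), hankelCoeff c p k i * s ^ i with hRdef
  set J : ℕ → ℝ → ℝ := fun i s => s ^ ((-c + i) - 1) * Real.exp (-(z * s)) with hJ
  have hJi : ∀ i, IntegrableOn (J i) (Set.Ioi 0) := fun i => hk_integrable (hpos i) hz
  have hbd : IntegrableOn (fun s => A * (J (n + 1) s + J (n + 1 + k) s)) (Set.Ioi 0) :=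
    ((hJi _).add (hJi _)).const_mul A
  have hle : ∀ᵐ s ∂(volume.restrict (Set.Ioi (0 : ℝ))),
      ‖w s * R s‖ ≤ A * (J (n + 1) s + J (n + 1 + k) s) := by
    refine (ae_restrict_iff' measurableSet_Ioi).mpr (ae_of_all _ fun s hs => ?_)
    have hs : 0 < s := hs
    have hw0 : 0 ≤ w s := by positivity
    rw [Real.norm_eq_abs, abs_mul, abs_of_nonneg hw0]
    have := mul_le_mul_of_nonneg_left (hR s hs) hw0
    refine this.trans (le_of_eq ?_)
    simp only [hJ]
    rw [← hk_mul hs, ← hk_mul hs]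
    ring
  have hmeas : Measurable (fun s => w s * R s) := by
    simp only [hw, hRdef, hankelExpandFn]
    fun_prop
  have hRi : IntegrableOn (fun s => w s * R s) (Set.Ioi 0) :=
    Integrable.mono' hbd hmeas.aestronglyMeasurable hle
  have hRn := norm_integral_le_of_norm_le hbd hle
  rw [integral_const_mul, integral_add (hJi _) (hJi _)] at hRn
  have hsplit : ∫ s in Set.Ioi (0 : ℝ), w s * hankelExpandFn c p k s
      = (∑ i ∈ Finset.range (n + 1), hankelCoeff c p k i * ∫ s in Set.Ioi (0 : ℝ), J i s)
        + ∫ s in Set.Ioi (0 : ℝ), w s * R s := by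
    have hSi : IntegrableOn (fun s => ∑ i ∈ Finset.range (n + 1), hankelCoeff c p k i * J i s)
        (Set.Ioi 0) := integrable_finsetSum _ fun i _ => (hJi i).const_mul _
    simp_rw [← integral_const_mul]
    rw [← integral_finsetSum _ fun i _ => (hJi i).const_mul _, ← integral_add hSi hRi]
    refine setIntegral_congr_fun measurableSet_Ioi fun s hs => ?_
    have hs : 0 < s := hs
    simp only [hJ, hRdef, hw]
    simp_rw [← hk_mul hs]
    rw [mul_sub, Finset.mul_sum]
    have : ∀ i ∈ Finset.range (n + 1),
      hankelCoeff c p k i * (s ^ (-c - 1) * Real.exp (-(z * s)) * s ^ i)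
      = s ^ (-c - 1) * Real.exp (-(z * s)) * (hankelCoeff c p k i * s ^ i) :=
      fun i _ => by ring
    rw [Finset.sum_congr rfl this]
    ring
  have hmain : ∑ i ∈ Finset.range (n + 1), hankelCoeffTilde c p k i * z ^ ((k : ℝ) - i)
      = z ^ ((k : ℝ) - c) / Real.Gamma (-c) *
        ∑ i ∈ Finset.range (n + 1), hankelCoeff c p k i * ∫ s in Set.Ioi (0 : ℝ), J i s := by
    rw [Finset.mul_sum]
    refine Finset.sum_congr rfl fun i _ => ?_
    have h := hk_val hc₂ hz k i
    rw [hk_gamma (-c) (by linarith)] at h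
    calc _ = hankelCoeff c p k i / Real.Gamma (-c) *
          ((∏ m ∈ Finset.range i, (-c + (m : ℝ))) * Real.Gamma (-c) * z ^ ((k : ℝ) - i)) := by
          unfold hankelCoeffTilde
          field_simp
      _ = _ := by rw [← h]; ring
  rw [hsplit, hmain, mul_add (z ^ ((k : ℝ) - c) / Real.Gamma (-c)), add_sub_cancel_left, abs_mul,
    abs_of_nonneg (show 0 ≤ z ^ ((k : ℝ) - c) / Real.Gamma (-c) by positivity)]
  have hv1 := hk_val hc₂ hz k (n + 1)
  have hv2 := hk_val hc₂ hz k (n + 1 + k)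
  have hzz : z ^ ((k : ℝ) - (n + 1 + k : ℕ)) ≤ z ^ ((k : ℝ) - n - 1) := by
    apply Real.rpow_le_rpow_of_exponent_le hz1
    have : (0 : ℝ) ≤ k := by positivity
    push_cast
    linarith
  have hze : z ^ ((k : ℝ) - (n + 1 : ℕ)) = z ^ ((k : ℝ) - n - 1) := by
    congr 1
    push_cast
    ring
  rw [Real.norm_eq_abs] at hRn
  calc _ ≤ z ^ ((k : ℝ) - c) / Real.Gamma (-c) * (A * ((∫ s in Set.Ioi (0 : ℝ), J (n + 1) s)
          + ∫ s in Set.Ioi (0 : ℝ), J (n + 1 + k) s)) :=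
        mul_le_mul_of_nonneg_left hRn (by positivity)
    _ = A / Real.Gamma (-c) * (z ^ ((k : ℝ) - c) * (∫ s in Set.Ioi (0 : ℝ), J (n + 1) s)
          + z ^ ((k : ℝ) - c) * ∫ s in Set.Ioi (0 : ℝ), J (n + 1 + k) s) := by ring
    _ = A / Real.Gamma (-c) * (Real.Gamma (-c + (n + 1 : ℕ)) * z ^ ((k : ℝ) - n - 1)
          + Real.Gamma (-c + (n + 1 + k : ℕ)) * z ^ ((k : ℝ) - (n + 1 + k : ℕ))) := by
        rw [← hze, ← hv1, ← hv2]
    _ ≤ A / Real.Gamma (-c) * (Real.Gamma (-c + (n + 1 : ℕ)) * z ^ ((k : ℝ) - n - 1)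
          + Real.Gamma (-c + (n + 1 + k : ℕ)) * z ^ ((k : ℝ) - n - 1)) := by
        gcongr
    _ = _ := by ring
end

section
/- One has lim_{z→+∞} z·(ψ_0(z) − 1) = c(1+c)(p−1)/2. -/
open MeasureTheory

noncomputable def hG (c : ℝ) (p : ℕ) (x : ℝ) : ℝ :=
  ((∑ i ∈ Finset.range p, (1 + x) ^ i) / p) ^ (-(c + 1))

lemma hS_lower (p : ℕ) (hp : 2 ≤ p) (x : ℝ) (hx : 0 ≤ x) :
    1 ≤ (∑ i ∈ Finset.range p, (1 + x) ^ i) / (p : ℝ) := by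
  have hp0 : (0 : ℝ) < p := by positivity
  rw [le_div_iff₀ hp0, one_mul]
  calc (p : ℝ) = ∑ i ∈ Finset.range p, (1 : ℝ) := by simp
    _ ≤ _ := Finset.sum_le_sum fun i _ => one_le_pow₀ (by linarith)

lemma hS_upper (p : ℕ) (hp : 2 ≤ p) (x : ℝ) (hx : 0 ≤ x) :
    (∑ i ∈ Finset.range p, (1 + x) ^ i) / (p : ℝ) ≤ (1 + x) ^ (p - 1) := by
  have hp0 : (0 : ℝ) < p := by positivity
  rw [div_le_iff₀ hp0]
  calc _ ≤ ∑ i ∈ Finset.range p, (1 + x) ^ (p - 1) :=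
        Finset.sum_le_sum fun i hi => pow_le_pow_right₀ (by linarith)
          (by have := Finset.mem_range.1 hi; omega)
    _ = _ := by simp [mul_comm]

lemma hG_bound (c : ℝ) (hc₁ : -1 < c) (p : ℕ) (hp : 2 ≤ p) (x : ℝ) (hx : 0 ≤ x) :
    |hG c p x - 1| ≤ (c + 1) * p * x := by
  have h1 := hS_lower p hp x hx
  have h2 := hS_upper p hp x hx
  unfold hG
  set y := (∑ i ∈ Finset.range p, (1 + x) ^ i) / (p : ℝ)
  have hy : 0 < y := by linarith
  have hle : y ^ (-(c + 1)) ≤ 1 := Real.rpow_le_one_of_one_le_of_nonpos h1 (by linarith)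
  rw [abs_of_nonpos (by linarith)]
  have hlog : Real.log y ≤ p * x := by
    calc Real.log y ≤ Real.log ((1 + x) ^ (p - 1)) := Real.log_le_log hy h2
      _ = ((p - 1 : ℕ) : ℝ) * Real.log (1 + x) := Real.log_pow _ _
      _ ≤ p * x := by
        have := Real.log_le_sub_one_of_pos (show 0 < 1 + x by linarith)
        have h3 : 0 ≤ Real.log (1 + x) := Real.log_nonneg (by linarith)
        have h4 : ((p - 1 : ℕ) : ℝ) ≤ p := by exact_mod_cast Nat.sub_le p 1
        apply mul_le_mul h4 (by linarith) h3 (by positivity)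
  rw [Real.rpow_def_of_pos hy]
  have := Real.add_one_le_exp (Real.log y * -(c + 1))
  nlinarith

lemma hG_zero (c : ℝ) (p : ℕ) (hp : 2 ≤ p) : hG c p 0 = 1 := by
  have hp0 : (p : ℝ) ≠ 0 := by positivity
  simp [hG, hp0]

lemma hG_deriv (c : ℝ) (p : ℕ) (hp : 2 ≤ p) :
    HasDerivAt (hG c p) (-(c + 1) * ((p : ℝ) - 1) / 2) 0 := by
  have hp0 : (p : ℝ) ≠ 0 := by positivity
  have h1 : HasDerivAt (fun x : ℝ => ∑ i ∈ Finset.range p, (1 + x) ^ i)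
      (∑ i ∈ Finset.range p, (i : ℝ)) 0 := by
    apply HasDerivAt.fun_sum
    intro i _
    have := ((hasDerivAt_id (0 : ℝ)).const_add 1).fun_pow i
    simpa using this
  have h2 : (∑ i ∈ Finset.range p, (i : ℝ)) = p * (p - 1) / 2 := by
    clear hp hp0 h1
    induction p with
    | zero => simp
    | succ n ih => rw [Finset.sum_range_succ, ih]; push_cast; ring
  have h3 := (h1.div_const (p : ℝ)).rpow_const (p := -(c + 1)) (by left; simp [hp0])
  unfold hG
  convert h3 using 1
  simp [hp0, h2]
  field_simp

lemma hankel_eq (c : ℝ) (p : ℕ) (hp : 2 ≤ p) (z : ℝ) (hz : 0 < z) :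
    genHankel c p 0 z = (1 / Real.Gamma (-c)) *
      ∫ t in Set.Ioi (0 : ℝ), Real.exp (-t) * t ^ (-c - 1) * hG c p (t / z) := by
  have hp0 : (0 : ℝ) < p := by positivity
  unfold genHankel
  set f : ℝ → ℝ := fun u => z ^ (-c) * (u * z) ^ 0 * Real.exp (-((u - 1) * z)) * (u ^ p - 1) ^ (-(c + 1)) with hf
  have e1 : ∫ u in Set.Ioi (1 : ℝ), f u = ∫ x in Set.Ioi (0 : ℝ), f (x + 1) := by
    have := (measurePreserving_add_right (volume : Measure ℝ) 1).setIntegral_preimage_emb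
      (measurableEmbedding_addRight 1) f (Set.Ioi 1)
    simpa using this.symm
  have e2 : ∫ x in Set.Ioi (0 : ℝ), f (x + 1) = z⁻¹ * ∫ t in Set.Ioi (0 : ℝ), f (t / z + 1) := by
    have := integral_comp_mul_left_Ioi (fun x => f (x + 1)) 0 (inv_pos.2 hz)
    simp only [mul_zero, smul_eq_mul, inv_inv] at this
    simp only [div_eq_inv_mul, this]
    field_simp
  rw [e1, e2, ← integral_const_mul, ← integral_const_mul, ← integral_const_mul]
  refine setIntegral_congr_fun measurableSet_Ioi fun t ht => ?_
  have ht : 0 < t := ht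
  have hx : 0 < t / z := by positivity
  have hS := hS_lower p hp (t / z) hx.le
  have hfac : (t / z + 1) ^ p - 1 = p * (t / z) * ((∑ i ∈ Finset.range p, (1 + t / z) ^ i) / p) := by
    have := geom_sum_mul (1 + t / z) p
    rw [add_comm (t / z) 1, ← this]
    field_simp
    ring
  simp only [hf, hG, hfac]
  rw [Real.mul_rpow (by positivity) (by linarith), Real.mul_rpow (by positivity) (by positivity),
    Real.div_rpow ht.le hz.le]
  have a1 : (p : ℝ) ^ (-(c + 1)) = ((p : ℝ) ^ (c + 1))⁻¹ := Real.rpow_neg hp0.le _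
  have a2 : z ^ (-(c + 1)) = z ^ (-c) * z⁻¹ := by
    rw [neg_add, Real.rpow_add hz, Real.rpow_neg_one]
  have a3 : (t / z + 1 - 1) * z = t := by field_simp; ring
  have a4 : -(c + 1) = -c - 1 := by ring
  have b1 : 0 < (p : ℝ) ^ (c + 1) := by positivity
  have b2 : 0 < z ^ (-c) := by positivity
  rw [a1, a2, a3, a4]
  field_simp

lemma hG_cont (c : ℝ) (p : ℕ) (hp : 2 ≤ p) : ContinuousOn (hG c p) (Set.Ici 0) := by
  unfold hG
  apply ContinuousOn.rpow_const
  · fun_prop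
  · intro x hx
    left
    have := hS_lower p hp x hx
    linarith

/-- Remark 1 of the paper.
`lim_{z→+∞} z (ψ₀(z) − 1) = c(1+c)(p−1)/2`. -/
theorem statement7 (c : ℝ) (hc₁ : -1 < c) (hc₂ : c < 0) (p : ℕ) (hp : 2 ≤ p) :
    Filter.Tendsto (fun z : ℝ => z * (genHankel c p 0 z - 1)) Filter.atTop
      (nhds (c * (1 + c) * ((p : ℝ) - 1) / 2)) := by
  have hΓ : 0 < Real.Gamma (-c) := Real.Gamma_pos_of_pos (by linarith)
  have I0 := Real.GammaIntegral_convergent (s := -c) (by linarith)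
  have I1 := Real.GammaIntegral_convergent (s := -c + 1) (by linarith)
  have meas : ∀ z : ℝ, 0 < z → AEStronglyMeasurable (fun t => Real.exp (-t) * t ^ (-c - 1) * (z * (hG c p (t / z) - 1))) (volume.restrict (Set.Ioi 0)) := by
    intro z hz
    refine I0.aestronglyMeasurable.mul (ContinuousOn.aestronglyMeasurable ?_ measurableSet_Ioi)
    refine continuousOn_const.mul (ContinuousOn.sub ?_ continuousOn_const)
    refine (hG_cont c p hp).comp (by fun_prop) ?_
    intro t ht
    have ht : 0 < t := ht
    exact Set.mem_Ici.2 (by positivity)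
  have Ib : Integrable (fun t => (c + 1) * p * (Real.exp (-t) * t ^ (-c + 1 - 1)))
      (volume.restrict (Set.Ioi (0 : ℝ))) := I1.const_mul _
  have hbound : ∀ z : ℝ, 0 < z → ∀ᵐ t ∂(volume.restrict (Set.Ioi (0 : ℝ))),
      ‖Real.exp (-t) * t ^ (-c - 1) * (z * (hG c p (t / z) - 1))‖ ≤
        (c + 1) * p * (Real.exp (-t) * t ^ (-c + 1 - 1)) := by
    intro z hz
    refine (ae_restrict_iff' measurableSet_Ioi).2 (Filter.Eventually.of_forall fun t ht => ?_)
    have ht : 0 < t := ht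
    have hb := hG_bound c hc₁ p hp (t / z) (by positivity)
    have e : t ^ (-c + 1 - 1) = t ^ (-c - 1) * t := by
      rw [← Real.rpow_add_one ht.ne']; congr 1; ring
    rw [norm_mul, norm_mul z, Real.norm_of_nonneg (by positivity : 0 ≤ Real.exp (-t) * t ^ (-c - 1)),
      Real.norm_of_nonneg hz.le, Real.norm_eq_abs, e]
    calc _ ≤ Real.exp (-t) * t ^ (-c - 1) * (z * ((c + 1) * p * (t / z))) := by gcongr
      _ = _ := by field_simp
  have key : ∀ z : ℝ, 0 < z → z * (genHankel c p 0 z - 1) = (1 / Real.Gamma (-c)) *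
      ∫ t in Set.Ioi (0 : ℝ), Real.exp (-t) * t ^ (-c - 1) * (z * (hG c p (t / z) - 1)) := by
    intro z hz
    have J : IntegrableOn (fun t => Real.exp (-t) * t ^ (-c - 1) * (z * (hG c p (t / z) - 1))) (Set.Ioi 0) :=
      Integrable.mono' Ib (meas z hz) (hbound z hz)
    rw [hankel_eq c p hp z hz]
    have e : ∫ t in Set.Ioi (0 : ℝ), Real.exp (-t) * t ^ (-c - 1) * hG c p (t / z) =
        z⁻¹ * (∫ t in Set.Ioi (0 : ℝ), Real.exp (-t) * t ^ (-c - 1) * (z * (hG c p (t / z) - 1)))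
        + Real.Gamma (-c) := by
      rw [Real.Gamma_eq_integral (by linarith : 0 < -c), ← integral_const_mul,
        ← integral_add (J.const_mul _) I0]
      congr 1
      ext t
      field_simp
      ring
    rw [e]
    field_simp
    ring
  have lim : Filter.Tendsto (fun z : ℝ => ∫ t in Set.Ioi (0 : ℝ), Real.exp (-t) * t ^ (-c - 1) * (z * (hG c p (t / z) - 1))) Filter.atTop
      (nhds (∫ t in Set.Ioi (0 : ℝ), (-(c + 1) * ((p : ℝ) - 1) / 2) * (Real.exp (-t) * t ^ (-c + 1 - 1)))) := by
    refine tendsto_integral_filter_of_dominated_convergence _ ?_ ?_ Ib ?_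
    · filter_upwards [Filter.eventually_gt_atTop 0] with z hz using meas z hz
    · filter_upwards [Filter.eventually_gt_atTop 0] with z hz using hbound z hz
    refine (ae_restrict_iff' measurableSet_Ioi).2 (Filter.Eventually.of_forall fun t ht => ?_)
    have ht : 0 < t := ht
    have e : t ^ (-c + 1 - 1) = t ^ (-c - 1) * t := by
      rw [← Real.rpow_add_one ht.ne']; congr 1; ring
    have hs := (hG_deriv c p hp).tendsto_slope_zero_right
    have ht0 : Filter.Tendsto (fun z : ℝ => t / z) Filter.atTop (nhdsWithin 0 (Set.Ioi 0)) := by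
      refine tendsto_nhdsWithin_iff.2 ⟨Filter.Tendsto.div_atTop tendsto_const_nhds Filter.tendsto_id, ?_⟩
      filter_upwards [Filter.eventually_gt_atTop 0] with z hz
      exact div_pos ht hz
    have h := (hs.comp ht0).const_mul (Real.exp (-t) * t ^ (-c - 1) * t)
    rw [e]
    refine (h.congr' ?_).trans_eq ?_
    · filter_upwards [Filter.eventually_gt_atTop 0] with z hz
      simp only [Function.comp, zero_add, hG_zero c p hp, smul_eq_mul]
      field_simp
    · congr 1; ring
  have fin := (lim.const_mul (1 / Real.Gamma (-c)))
  rw [integral_const_mul, ← Real.Gamma_eq_integral (by linarith : 0 < -c + 1),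
    Real.Gamma_add_one (by linarith)] at fin
  refine (fin.congr' ?_).trans_eq ?_
  · filter_upwards [Filter.eventually_gt_atTop 0] with z hz using (key z hz).symm
  · congr 1; field_simp; ring
end
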